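/- Let 𝔽_q be a finite field of characteristic p and let φ ∈ 𝔽_q(x) have degree d with 2 ≤ d < p. Fix n ≥ 1, let F_n(x) be the numerator of φ^n(x) − t, a separable polynomial of degree d^n in x over 𝔽_q(t), let K_n^arith be its splitting field over 𝔽_q(t), and let m be defined by K_n^arith ∩ 𝔽̄_q = 𝔽_{q^m} (so 𝔽_{q^m} is the maximal constant field subextension of K_n^arith). Let G_n = Gal(K_n^arith / 𝔽_{q^m}(t)), acting on the d^n roots of F_n, and let FPP(G_n) be the proportion of elements of G_n fixing at least one root. Then for every δ > 0 there is a constant k₀ such that for all integers k > k₀, #Per(φ, ℙ¹(𝔽_{q^{mk}}))/(q^{mk} + 1) < FPP(G_n) + δ. -/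

import Mathlib

open Polynomial

/-- Composition of the pair `(p, q)` (representing `p/q`) with the pair `(r, s)`:
homogenization of the substitution `x ↦ r/s`, giving a pair representing
`(p/q) ∘ (r/s)`. -/
noncomputable def pairComp {K : Type*} [CommRing K] (p q r s : Polynomial K) :
    Polynomial K × Polynomial K :=
  (∑ i ∈ Finset.range (max p.natDegree q.natDegree + 1),
      C (p.coeff i) * r ^ i * s ^ (max p.natDegree q.natDegree - i),
   ∑ i ∈ Finset.range (max p.natDegree q.natDegree + 1),
      C (q.coeff i) * r ^ i * s ^ (max p.natDegree q.natDegree - i))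

/-- The pair `(p_n, q_n)` representing the `n`-th iterate `φ^n = p_n/q_n` of the
rational function `φ = p/q` (with `φ^0 = x`). -/
noncomputable def iterPair {K : Type*} [CommRing K] (p q : Polynomial K) :
    ℕ → Polynomial K × Polynomial K
  | 0 => (X, 1)
  | n + 1 => pairComp p q (iterPair p q n).1 (iterPair p q n).2

/-- The numerator of `φ^n(x) - t` as a polynomial in `x` over the function field
`F(t) = RatFunc F`: namely `p_n(x) - t · q_n(x)` where `φ^n = p_n/q_n`. -/
noncomputable def PhiPoly (F : Type*) [Field F] (p q : Polynomial F) (n : ℕ) :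
    Polynomial (RatFunc F) :=
  ((iterPair p q n).1).map (RatFunc.C : F →+* RatFunc F)
    - Polynomial.C RatFunc.X * ((iterPair p q n).2).map (RatFunc.C : F →+* RatFunc F)

/-- `x` is algebraic over `A` (with respect to the ring map `σ : A →+* B`). -/
def algebraicOver {A B : Type*} [CommRing A] [CommRing B] (σ : A →+* B) (x : B) : Prop :=
  ∃ P : Polynomial A, P ≠ 0 ∧ Polynomial.eval₂ σ x P = 0



open Classical in
/-- The self-map of `ℙ¹(Ω) = Ω ∪ {∞}` (modeled as `Option Ω`, with `none = ∞`)
induced by the rational function `p/q`, where `p q : Polynomial Ω` are assumed coprime. -/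
noncomputable def ratMapP1 {Ω : Type*} [Field Ω] (p q : Polynomial Ω) : Option Ω → Option Ω :=
  fun z => match z with
  | some a => if q.eval a = 0 then none else some (p.eval a / q.eval a)
  | none =>
      if q.natDegree < p.natDegree then none
      else if p.natDegree < q.natDegree then some 0
      else some (p.leadingCoeff / q.leadingCoeff)

open Classical in
/-- The Möbius transformation `z ↦ (a z + b)/(c z + d)` of `ℙ¹(Ω)`, for an
invertible matrix `(a b; c d)`. -/
noncomputable def mobiusMap {Ω : Type*} [Field Ω] (a b c d : Ω) : Option Ω → Option Ω :=
  fun z => match z with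
  | some x => if c * x + d = 0 then none else some ((a * x + b) / (c * x + d))
  | none => if c = 0 then none else some (a / c)

open Classical in
/-- The ramification index of the rational function `p/q` at a finite point `x`. -/
noncomputable def ramAt {Ω : Type*} [Field Ω] (p q : Polynomial Ω) (x : Ω) : ℕ :=
  if q.eval x = 0 then Polynomial.rootMultiplicity x q
  else Polynomial.rootMultiplicity x (p - C (p.eval x / q.eval x) * q)

/-- The ramification index `e_{p/q}(α)` of the rational function `p/q` at a point
`α ∈ ℙ¹(Ω)`; the index at `∞` is computed from the reversed polynomials. -/
noncomputable def ramIdxP1 {Ω : Type*} [Field Ω] (p q : Polynomial Ω) : Option Ω → ℕ :=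
  fun z => match z with
  | some x => ramAt p q x
  | none =>
      ramAt (p.reverse * X ^ (max p.natDegree q.natDegree - p.natDegree))
            (q.reverse * X ^ (max p.natDegree q.natDegree - q.natDegree)) 0

/-- The set of critical points in `ℙ¹(Ω)` of the rational function `p/q`. -/
def critSetP1 {Ω : Type*} [Field Ω] (p q : Polynomial Ω) : Set (Option Ω) :=
  {α | 1 < ramIdxP1 p q α}

/-- The post-critical set `P_φ = ⋃_{k ≥ 1} φ^k(C_φ)` of `φ = p/q`. -/
def postCritP1 {Ω : Type*} [Field Ω] (p q : Polynomial Ω) : Set (Option Ω) :=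
  ⋃ k : ℕ, (ratMapP1 p q)^[k + 1] '' critSetP1 p q

/-- `φ = p/q` is a Lattès map: there is `r : ℙ¹(Ω) → ℤ` with
`r(φ(α)) = e_φ(α) · r(α)` for all `α` and `r(α) = 1` outside the post-critical set. -/
def IsLattesPair {Ω : Type*} [Field Ω] (p q : Polynomial Ω) : Prop :=
  ∃ r : Option Ω → ℤ,
    (∀ α : Option Ω, r (ratMapP1 p q α) = ramIdxP1 p q α * r α) ∧
    ∀ α : Option Ω, α ∉ postCritP1 p q → r α = 1

/-- The rational maps `p/q` and `r/s` are Möbius-conjugate over `Ω`: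
`(r/s) ∘ μ = μ ∘ (p/q)` on `ℙ¹(Ω)` for some Möbius transformation `μ`. -/
def MobiusConjugate {Ω : Type*} [Field Ω] (p q r s : Polynomial Ω) : Prop :=
  ∃ a b c d : Ω, a * d - b * c ≠ 0 ∧
    ∀ z : Option Ω, ratMapP1 r s (mobiusMap a b c d z) = mobiusMap a b c d (ratMapP1 p q z)

/-- `φ = p/q` is dynamically exceptional: there is a finite nonempty
`Γ ⊆ ℙ¹(Ω)` with `φ⁻¹(Γ) \ C_φ = Γ`. -/
def DynExceptional {Ω : Type*} [Field Ω] (p q : Polynomial Ω) : Prop :=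
  ∃ Γ : Set (Option Ω), Γ.Finite ∧ Γ.Nonempty ∧
    (ratMapP1 p q) ⁻¹' Γ \ critSetP1 p q = Γ

/-- The number of points of `ℙ¹(𝔽_{q^N})` (realized inside `ℙ¹` of the algebraic
closure of `F`, where `q = #F`) that are periodic under the rational map `p/q`. -/
noncomputable def perCount (F : Type*) [Field F] [Fintype F] (p q : Polynomial F)
    (N : ℕ) : ℕ :=
  Set.ncard {α : Option (AlgebraicClosure F) |
    (α = none ∨ ∃ a : AlgebraicClosure F, α = some a ∧ a ^ Fintype.card F ^ N = a) ∧
    ∃ m : ℕ, 1 ≤ m ∧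
      (ratMapP1 (p.map (algebraMap F (AlgebraicClosure F)))
        (q.map (algebraMap F (AlgebraicClosure F))))^[m] α = α}

open Polynomial

section DegreeFiltration

variable {k A ι : Type*} [Field k] [CommRing A] [Algebra k[X] A] [Algebra k A]
  [IsScalarTower k k[X] A]

theorem mul_mem_degreeLT {a b : ℕ} {f g : k[X]} (hf : f ∈ degreeLT k a) (hg : g ∈ degreeLT k b) :
    f * g ∈ degreeLT k (a + b) := by
  rw [mem_degreeLT] at *
  rcases eq_or_ne f 0 with rfl | hf0
  · simp
  rcases eq_or_ne g 0 with rfl | hg0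
  · simp
  rw [degree_mul]
  rw [degree_eq_natDegree hf0, degree_eq_natDegree hg0] at *
  norm_cast at *
  omega

theorem exists_forall_mem_degreeLT {σ : Type*} [Finite σ] (f : σ → k[X]) :
    ∃ c, ∀ i, f i ∈ degreeLT k c := by
  cases nonempty_fintype σ
  refine ⟨Finset.univ.sup (fun i => (f i).natDegree) + 1, fun i => ?_⟩
  rw [mem_degreeLT]
  refine degree_le_natDegree.trans_lt ?_
  norm_cast
  exact Nat.lt_succ_of_le (Finset.le_sup (f := fun i => (f i).natDegree) (Finset.mem_univ i))

/-- The elements whose coordinates in a given basis over `k[X]` all have degree less than `n`. -/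
noncomputable def degreeFiltration (e : Module.Basis ι k[X] A) (n : ℕ) : Submodule k A :=
  ⨅ i, (degreeLT k n).comap ((e.coord i).restrictScalars k)

theorem mem_degreeFiltration {e : Module.Basis ι k[X] A} {n : ℕ} {y : A} :
    y ∈ degreeFiltration e n ↔ ∀ i, e.repr y i ∈ degreeLT k n := by
  simp [degreeFiltration, Submodule.mem_iInf]

theorem degreeFiltration_mono (e : Module.Basis ι k[X] A) : Monotone (degreeFiltration e) := by
  intro a b hab y hy
  rw [mem_degreeFiltration] at *
  exact fun i => degreeLT_mono hab (hy i)

theorem exists_mem_degreeFiltration [Finite ι] (e : Module.Basis ι k[X] A) (y : A) :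
    ∃ n, y ∈ degreeFiltration e n := by
  simpa only [mem_degreeFiltration] using exists_forall_mem_degreeLT (fun i => e.repr y i)

/-- The filtration step as a power of a space of polynomials of bounded degree. -/
noncomputable def degreeFiltrationEquiv [Fintype ι] (e : Module.Basis ι k[X] A) (n : ℕ) :
    degreeFiltration e n ≃ₗ[k] (ι → degreeLT k n) where
  toFun y i := ⟨e.repr y.1 i, mem_degreeFiltration.1 y.2 i⟩
  map_add' x y := by ext; simp
  map_smul' c x := by
    funext i
    apply Subtype.ext
    exact ((e.coord i).restrictScalars k).map_smul c x.1
  invFun v := ⟨e.equivFun.symm (fun i => (v i).1), by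
    rw [mem_degreeFiltration]
    intro i
    rw [← e.equivFun_apply, LinearEquiv.apply_symm_apply]
    exact (v i).2⟩
  left_inv y := by
    apply Subtype.ext
    exact e.equivFun.symm_apply_apply y.1
  right_inv v := by
    funext i
    apply Subtype.ext
    exact congrFun (e.equivFun.apply_symm_apply (fun i => (v i).1)) i

instance [Finite ι] (e : Module.Basis ι k[X] A) (n : ℕ) :
    FiniteDimensional k (degreeFiltration e n) := by
  cases nonempty_fintype ι
  have : FiniteDimensional k (degreeLT k n) := Module.Finite.equiv (degreeLTEquiv k n).symm
  exact Module.Finite.equiv (degreeFiltrationEquiv e n).symm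

theorem finrank_degreeFiltration [Fintype ι] (e : Module.Basis ι k[X] A) (n : ℕ) :
    Module.finrank k (degreeFiltration e n) = Fintype.card ι * n := by
  have : FiniteDimensional k (degreeLT k n) := Module.Finite.equiv (degreeLTEquiv k n).symm
  rw [(degreeFiltrationEquiv e n).finrank_eq, Module.finrank_pi_fintype]
  simp [(degreeLTEquiv k n).finrank_eq]

theorem exists_mul_mem_degreeFiltration [Finite ι] (e : Module.Basis ι k[X] A) :
    ∃ c, ∀ a b y z, y ∈ degreeFiltration e a → z ∈ degreeFiltration e b →
      y * z ∈ degreeFiltration e (a + b + c) := by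
  cases nonempty_fintype ι
  obtain ⟨c, hc⟩ := exists_forall_mem_degreeLT
    (fun t : ι × ι × ι => e.repr (e t.1 * e t.2.1) t.2.2)
  refine ⟨c, fun a b y z hy hz => ?_⟩
  rw [mem_degreeFiltration] at *
  intro l
  have h : e.repr (y * z) l = ∑ i, ∑ j, e.repr y i * e.repr z j * e.repr (e i * e j) l := by
    conv_lhs => rw [← e.sum_repr y, ← e.sum_repr z, Finset.sum_mul_sum]
    simp only [smul_mul_smul_comm, map_sum, map_smul, Finsupp.finsetSum_apply, Finsupp.smul_apply,
      smul_eq_mul]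
  rw [h]
  exact Submodule.sum_mem _ fun i _ => Submodule.sum_mem _ fun j _ =>
    mul_mem_degreeLT (mul_mem_degreeLT (hy i) (hz j)) (hc (i, j, l))

theorem exists_map_mem_degreeFiltration [Finite ι] (e : Module.Basis ι k[X] A)
    (g : A →ₗ[k[X]] A) :
    ∃ c, ∀ a y, y ∈ degreeFiltration e a → g y ∈ degreeFiltration e (a + c) := by
  cases nonempty_fintype ι
  obtain ⟨c, hc⟩ := exists_forall_mem_degreeLT (fun t : ι × ι => e.repr (g (e t.1)) t.2)
  refine ⟨c, fun a y hy => ?_⟩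
  rw [mem_degreeFiltration] at *
  intro l
  have h : e.repr (g y) l = ∑ i, e.repr y i * e.repr (g (e i)) l := by
    conv_lhs => rw [← e.sum_repr y, map_sum]
    simp [Finsupp.finsetSum_apply]
  rw [h]
  exact Submodule.sum_mem _ fun i _ => mul_mem_degreeLT (hy i) (hc (i, l))

theorem pow_mem_degreeFiltration {e : Module.Basis ι k[X] A} {c : ℕ}
    (hmul : ∀ a b y z, y ∈ degreeFiltration e a → z ∈ degreeFiltration e b →
      y * z ∈ degreeFiltration e (a + b + c)) (hone : (1 : A) ∈ degreeFiltration e c)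
    {a : ℕ} {y : A} (hy : y ∈ degreeFiltration e a) (n : ℕ) :
    y ^ n ∈ degreeFiltration e (n * (a + c) + c) := by
  induction n with
  | zero => simpa using hone
  | succ n ih =>
    rw [pow_succ]
    convert hmul _ _ _ _ ih hy using 2
    ring

theorem natDegree_det_le_card_mul [Fintype ι] [DecidableEq ι] (M : Matrix ι ι k[X]) (s : ℕ)
    (hM : ∀ i j, M i j ∈ degreeLT k s) : M.det.natDegree ≤ Fintype.card ι * s := by
  rw [Matrix.det_apply]
  refine natDegree_sum_le_of_forall_le _ _ fun σ _ => ?_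
  refine (natDegree_smul_le _ _).trans ?_
  refine (natDegree_prod_le _ _).trans ?_
  refine (Finset.sum_le_card_nsmul _ _ s fun i _ => ?_).trans (by simp)
  exact natDegree_le_of_degree_le (mem_degreeLT.1 (hM _ _)).le

theorem ncard_algHom_zeros_le [Fintype ι] [IsDomain A] {Ω : Type*} [Field Ω] [Algebra k Ω]
    (e : Module.Basis ι k[X] A) {c s : ℕ}
    (hmul : ∀ a b y z, y ∈ degreeFiltration e a → z ∈ degreeFiltration e b →
      y * z ∈ degreeFiltration e (a + b + c))
    (hbasis : ∀ i, e i ∈ degreeFiltration e c) {w : A} (hw : w ≠ 0)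
    (hws : w ∈ degreeFiltration e s) :
    {P : A →ₐ[k] Ω | P w = 0}.Finite ∧
      {P : A →ₐ[k] Ω | P w = 0}.ncard ≤ Fintype.card ι * (s + c + c) := by
  classical
  have hdeg : (Algebra.norm k[X] w).natDegree ≤ Fintype.card ι * (s + c + c) := by
    rw [Algebra.norm_eq_matrix_det e]
    refine natDegree_det_le_card_mul _ _ fun i j => ?_
    rw [Algebra.leftMulMatrix_eq_repr_mul]
    exact mem_degreeFiltration.1 (hmul _ _ _ _ hws (hbasis j)) i
  set I : Ideal A := Ideal.span {w} with hI
  have hfr : Module.finrank k (A ⧸ I) = (Algebra.norm k[X] w).natDegree :=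
    finrank_quotient_span_eq_natDegree_norm e hw
  have hfin : FiniteDimensional k (A ⧸ I) := by
    have hI0 : I ≠ ⊥ := by rwa [hI, Ne, Ideal.span_singleton_eq_bot]
    exact Module.Finite.equiv (Ideal.quotientEquivDirectSum k e hI0).symm
  have hind : LinearIndependent Ω
      (AlgHom.toLinearMap : ((A ⧸ I) →ₐ[k] Ω) → (A ⧸ I) →ₗ[k] Ω) :=
    linearIndependent_toLinearMap k (A ⧸ I) Ω
  have hdim : Module.finrank Ω ((A ⧸ I) →ₗ[k] Ω) = Module.finrank k (A ⧸ I) := by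
    simp [Module.finrank_linearMap_self]
  have hFin : Finite ((A ⧸ I) →ₐ[k] Ω) := hind.finite
  have hcard : Nat.card ((A ⧸ I) →ₐ[k] Ω) ≤ Module.finrank k (A ⧸ I) := by
    cases nonempty_fintype ((A ⧸ I) →ₐ[k] Ω)
    rw [Nat.card_eq_fintype_card, ← hdim]
    exact hind.fintype_card_le_finrank
  have hsub : {P : A →ₐ[k] Ω | P w = 0} ⊆
      Set.range (fun P : (A ⧸ I) →ₐ[k] Ω => P.comp (Ideal.Quotient.mkₐ k I)) := by
    intro P hP
    refine ⟨Ideal.Quotient.liftₐ I P ?_, ?_⟩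
    · intro a ha
      obtain ⟨b, rfl⟩ := Ideal.mem_span_singleton.1 ha
      rw [map_mul, show P w = 0 from hP, zero_mul]
    · ext x
      rfl
  refine ⟨(Set.finite_range _).subset hsub, ?_⟩
  calc _ ≤ (Set.range (fun P : (A ⧸ I) →ₐ[k] Ω => P.comp (Ideal.Quotient.mkₐ k I))).ncard :=
        Set.ncard_le_ncard hsub (Set.finite_range _)
    _ ≤ Nat.card ((A ⧸ I) →ₐ[k] Ω) := by
        rw [← Set.image_univ, ← Set.ncard_univ]
        exact Set.ncard_image_le (Set.toFinite _)
    _ ≤ _ := (hcard.trans hfr.le).trans hdeg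

end DegreeFiltration

section PowerSeriesIndependence

variable {Ω J : Type*} [Field Ω] [Fintype J]

theorem exists_pow_X_dvd_imp_eq_zero {v : J → PowerSeries Ω} (hv : LinearIndependent Ω v) :
    ∃ N, ∀ c : J → Ω, (PowerSeries.X : PowerSeries Ω) ^ N ∣ ∑ j, c j • v j → c = 0 := by
  let T : (J → Ω) →ₗ[Ω] PowerSeries Ω := Fintype.linearCombination Ω v
  let W : ℕ →o (Submodule Ω (J → Ω))ᵒᵈ :=
    { toFun := fun n => OrderDual.toDual
        (((Ideal.span {(PowerSeries.X : PowerSeries Ω) ^ n}).restrictScalars Ω).comap T)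
      monotone' := by
        intro a b hab c hc
        have hc' : (PowerSeries.X : PowerSeries Ω) ^ b ∣ T c := Ideal.mem_span_singleton.1 hc
        exact Ideal.mem_span_singleton.2 ((pow_dvd_pow _ hab).trans hc') }
  obtain ⟨N, hN⟩ := IsArtinian.monotone_stabilizes W
  refine ⟨N, fun c hc => ?_⟩
  have h1 : ∀ m, (PowerSeries.X : PowerSeries Ω) ^ m ∣ T c := by
    intro m
    rcases le_total m N with h | h
    · exact (pow_dvd_pow _ h).trans hc
    · have h2 : c ∈ OrderDual.ofDual (W m) := by
        rw [← hN m h]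
        exact Ideal.mem_span_singleton.2 hc
      exact Ideal.mem_span_singleton.1 h2
  have h3 : T c = 0 := by
    ext m
    exact PowerSeries.X_pow_dvd_iff.1 (h1 (m + 1)) m (Nat.lt_succ_self m)
  funext j
  exact Fintype.linearIndependent_iff.1 hv c h3 j

theorem eq_zero_of_sum_mul_pow_eq_zero {p : ℕ} [ExpChar Ω p] {v : J → PowerSeries Ω} {N s : ℕ}
    (hN : ∀ c : J → Ω, (PowerSeries.X : PowerSeries Ω) ^ N ∣ ∑ j, c j • v j → c = 0)
    (hs : N ≤ p ^ s) {r : J → PowerSeries Ω} (hr : ∑ j, v j * r j ^ p ^ s = 0) : r = 0 := by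
  have : ExpChar (PowerSeries Ω) p :=
    expChar_of_injective_ringHom (PowerSeries.C_injective (R := Ω)) p
  have hp0 : p ^ s ≠ 0 := pow_ne_zero _ (expChar_pos Ω p).ne'
  have key : ∀ r : J → PowerSeries Ω, ∑ j, v j * r j ^ p ^ s = 0 →
      ∀ j, (PowerSeries.X : PowerSeries Ω) ∣ r j := by
    intro r hr j
    rw [PowerSeries.X_dvd_iff]
    have hd : ∀ j, (PowerSeries.X : PowerSeries Ω) ^ p ^ s ∣
        r j ^ p ^ s - PowerSeries.C (PowerSeries.constantCoeff (r j)) ^ p ^ s := by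
      intro j
      rw [← sub_pow_expChar_pow]
      apply pow_dvd_pow_of_dvd
      rw [PowerSeries.X_dvd_iff]
      simp
    have h0 := hN (fun j => PowerSeries.constantCoeff (r j) ^ p ^ s) <| by
      refine (pow_dvd_pow _ hs).trans ?_
      have : ∑ j, (PowerSeries.constantCoeff (r j) ^ p ^ s) • v j =
          - ∑ j, v j * (r j ^ p ^ s - PowerSeries.C (PowerSeries.constantCoeff (r j)) ^ p ^ s) := by
        simp only [mul_sub, Finset.sum_sub_distrib, hr, zero_sub, neg_neg]
        refine Finset.sum_congr rfl fun j _ => ?_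
        rw [PowerSeries.smul_eq_C_mul, map_pow, mul_comm]
      rw [this]
      exact (Finset.dvd_sum fun j _ => (hd j).mul_left _).neg_right
    exact (pow_eq_zero_iff hp0).1 (congrFun h0 j)
  have all : ∀ n, ∀ r : J → PowerSeries Ω, ∑ j, v j * r j ^ p ^ s = 0 →
      ∀ j, (PowerSeries.X : PowerSeries Ω) ^ n ∣ r j := by
    intro n
    induction n with
    | zero => intro r _ j; simp
    | succ n ih =>
      intro r hr j
      choose t ht using key r hr
      have ht0 : ∑ j, v j * t j ^ p ^ s = 0 := by
        have : (PowerSeries.X : PowerSeries Ω) ^ p ^ s * ∑ j, v j * t j ^ p ^ s = 0 := by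
          rw [← hr, Finset.mul_sum]
          refine Finset.sum_congr rfl fun j _ => ?_
          rw [ht j, mul_pow]; ring
        exact (mul_eq_zero.1 this).resolve_left (pow_ne_zero _ PowerSeries.X_ne_zero)
      rw [ht j, pow_succ']
      exact mul_dvd_mul_left _ (ih t ht0 j)
  funext j
  ext m
  exact PowerSeries.X_pow_dvd_iff.1 (all (m + 1) r hr j) m (Nat.lt_succ_self m)

end PowerSeriesIndependence

section Stepanov

/-- Choice of parameters in the polynomial method. -/
theorem exists_stepanov_parameters (D c : ℕ) (hD : 0 < D) {ε : ℝ} (hε : 0 < ε) :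
    ∃ B : ℕ, ∃ M : ℝ, ∀ μ ν : ℕ, 0 < ν → M ≤ μ → ∃ a : ℕ,
      μ * (B + c) + c + a + c < B * (D * a) ∧
      (D * (B + (ν * (a + c + c) + c) + c + c + c) : ℝ) ≤ (1 + ε) * (μ * ν) := by
  have hD1 : (1 : ℝ) ≤ D := by exact_mod_cast hD
  set η : ℝ := ε / 2 with hη
  have hη0 : 0 < η := by positivity
  obtain ⟨B, hB⟩ := exists_nat_gt ((1 + η + c + (2 * c + 1)) / η + 1)
  have hB1 : (1 : ℝ) < B := lt_of_le_of_lt (by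
    have : (0:ℝ) ≤ (1 + η + c + (2 * c + 1)) / η := by positivity
    linarith) hB
  have hBη : 1 + η + c + (2 * c + 1) < B * η := by
    have h1 : (1 + η + c + (2 * c + 1)) / η < B := by linarith
    rwa [div_lt_iff₀ hη0] at h1
  set K : ℝ := D * (B + 6 * c + 1) with hK
  refine ⟨B, K / η + 1, fun μ ν hν hμ => ?_⟩
  have hν1 : (1 : ℝ) ≤ ν := by exact_mod_cast hν
  have hKη : 0 ≤ K / η := by positivity
  have hμ1 : (1 : ℝ) ≤ μ := by linarith
  have hμK : K ≤ η * μ := by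
    have h1 : K / η ≤ μ := by linarith
    rw [div_le_iff₀ hη0] at h1
    linarith
  set a := ⌊μ * (1 + η) / D⌋₊ + 1 with ha
  have ha1 : μ * (1 + η) ≤ D * (a : ℝ) := by
    have := (Nat.lt_floor_add_one (μ * (1 + η) / D : ℝ)).le
    rw [div_le_iff₀ (by linarith)] at this
    push_cast [ha]
    linarith
  have ha2 : D * (a : ℝ) ≤ μ * (1 + η) + D := by
    have := Nat.floor_le (show (0:ℝ) ≤ μ * (1 + η) / D by positivity)
    rw [le_div_iff₀ (by linarith)] at this
    push_cast [ha]
    linarith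
  refine ⟨a, ?_, ?_⟩
  · have h1 : (μ * (B + c) + c + a + c : ℝ) < B * (D * a) := by
      have h2 : (B - 1) * (μ * (1 + η)) ≤ (B - 1) * (D * (a : ℝ)) :=
        mul_le_mul_of_nonneg_left ha1 (by linarith)
      have h3 : (a : ℝ) ≤ D * a := by nlinarith [Nat.cast_nonneg (α := ℝ) a]
      have h5 : (μ : ℝ) * (2 * c + 1) ≤ μ * (B * η - (1 + η + c)) :=
        mul_le_mul_of_nonneg_left (by linarith) (by linarith)
      have h6 : (2 * c + 1 : ℝ) ≤ μ * (2 * c + 1) := by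
        have : (0 : ℝ) ≤ 2 * c + 1 := by positivity
        nlinarith
      nlinarith
    exact_mod_cast h1
  · have h1 : (ν : ℝ) * (D * a) ≤ ν * (μ * (1 + η) + D) :=
      mul_le_mul_of_nonneg_left ha2 (by linarith)
    have h2 : (ν : ℝ) * K ≤ ν * (η * μ) := mul_le_mul_of_nonneg_left hμK (by linarith)
    have h3 : (D * (B + 4 * c) : ℝ) ≤ ν * (D * (B + 4 * c)) := by
      have : (0 : ℝ) ≤ D * (B + 4 * c) := by positivity
      nlinarith
    have h4 : ε = 2 * η := by rw [hη]; ring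
    rw [hK] at h2
    rw [h4]
    linarith

/-- **Stepanov's method**, twisted by an automorphism: an upper bound for the number of points on
which the Frobenius acts as a given automorphism of the coordinate ring. -/
theorem eventually_ncard_frobenius_eq_le {k A ι Ω : Type*} [Field k] [Finite k] [CommRing A]
    [IsDomain A] [Algebra k[X] A] [Algebra k A] [IsScalarTower k k[X] A] [Finite ι] [Field Ω]
    [Algebra k Ω] (e : Module.Basis ι k[X] A) (φ : A →ₐ[k] PowerSeries Ω)
    (hφ : ∀ (n : ℕ) (u : Fin n → A), LinearIndependent k u → LinearIndependent Ω (φ ∘ u))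
    (g : A ≃ₐ[k[X]] A) {ε : ℝ} (hε : 0 < ε) :
    ∀ᶠ n in Filter.atTop, {P : A →ₐ[k] Ω | ∀ x, P x ^ Nat.card k ^ n = P (g x)}.Finite ∧
      ({P : A →ₐ[k] Ω | ∀ x, P x ^ Nat.card k ^ n = P (g x)}.ncard : ℝ) ≤
        (1 + ε) * (Nat.card k : ℝ) ^ n := by
  cases nonempty_fintype k
  cases nonempty_fintype ι
  obtain ⟨p, hp⟩ := CharP.exists k
  obtain ⟨f, hp', hf⟩ := FiniteField.card k p
  rw [← Nat.card_eq_fintype_card] at hf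
  generalize (f : ℕ) = f at hf
  have hpk : ExpChar k p := ExpChar.prime hp'
  have hpΩ : ExpChar Ω p := expChar_of_injective_algebraMap (algebraMap k Ω).injective p
  have hq1 : 1 < Nat.card k := Finite.one_lt_card
  have hι : 0 < Fintype.card ι := Fintype.card_pos_iff.2 e.index_nonempty
  obtain ⟨c₁, hc₁⟩ := exists_mul_mem_degreeFiltration e
  obtain ⟨c₂, hc₂⟩ := exists_map_mem_degreeFiltration e g.symm.toLinearMap
  obtain ⟨c₃, hc₃⟩ := exists_mem_degreeFiltration e (1 : A)
  choose c₄ hc₄ using fun i => exists_mem_degreeFiltration e (e i)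
  set c := c₁ + c₂ + c₃ + Finset.univ.sup c₄ with hc
  have hmul : ∀ a b y z, y ∈ degreeFiltration e a → z ∈ degreeFiltration e b →
      y * z ∈ degreeFiltration e (a + b + c) := fun a b y z hy hz =>
    degreeFiltration_mono e (by omega) (hc₁ a b y z hy hz)
  have hmap : ∀ a y, y ∈ degreeFiltration e a → g.symm y ∈ degreeFiltration e (a + c) :=
    fun a y hy => degreeFiltration_mono e (by omega) (hc₂ a y hy)
  have hone : (1 : A) ∈ degreeFiltration e c := degreeFiltration_mono e (by omega) hc₃
  have hbasis : ∀ i, e i ∈ degreeFiltration e c := fun i =>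
    degreeFiltration_mono e (by
      have := Finset.le_sup (f := c₄) (Finset.mem_univ i)
      omega) (hc₄ i)
  obtain ⟨B, M, hBM⟩ := exists_stepanov_parameters (Fintype.card ι) c hι hε
  set b := Module.finBasis k (degreeFiltration e B)
  set u : Fin (Module.finrank k (degreeFiltration e B)) → A := fun j => (b j : A) with hu
  have huB : ∀ j, u j ∈ degreeFiltration e B := fun j => (b j).2
  have huind : LinearIndependent k u :=
    b.linearIndependent.map' (degreeFiltration e B).subtype (Submodule.ker_subtype _)
  obtain ⟨N, hN⟩ := exists_pow_X_dvd_imp_eq_zero (hφ _ u huind)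
  obtain ⟨M', hM'⟩ := exists_nat_gt M
  filter_upwards [Filter.eventually_ge_atTop (2 * (N + M'))] with n hn
  set ν := Nat.card k ^ (n / 2) with hν
  set μ := Nat.card k ^ (n - n / 2) with hμ
  have hμν : μ * ν = Nat.card k ^ n := by
    rw [hμ, hν, ← pow_add]; congr 1; omega
  have hνN : N ≤ ν := by
    have : n / 2 < ν := Nat.lt_pow_self hq1
    omega
  have hμM : M ≤ μ := by
    have : n - n / 2 < μ := Nat.lt_pow_self hq1
    have h2 : M' ≤ μ := by omega
    exact hM'.le.trans (by exact_mod_cast h2)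
  obtain ⟨a, ha, hbound⟩ := hBM μ ν (Nat.pos_of_ne_zero (by positivity)) hμM
  let Ψ : (Fin (Module.finrank k (degreeFiltration e B)) → degreeFiltration e a) →ₗ[k]
      degreeFiltration e (μ * (B + c) + c + a + c) :=
    LinearMap.codRestrict _
      (∑ j, (LinearMap.mulLeft k (u j ^ μ)) ∘ₗ (degreeFiltration e a).subtype ∘ₗ LinearMap.proj j)
      (fun r => by
        rw [LinearMap.sum_apply]
        exact Submodule.sum_mem _ fun j _ =>
          hmul _ _ _ _ (pow_mem_degreeFiltration hmul hone (huB j) μ) (r j).2)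
  have hΨ : ∀ r, (Ψ r : A) = ∑ j, u j ^ μ * r j := fun r => by
    simp [Ψ, LinearMap.sum_apply]
  obtain ⟨r, hr, hr0⟩ : ∃ r, Ψ r = 0 ∧ r ≠ 0 := by
    have hlt : Module.finrank k (degreeFiltration e (μ * (B + c) + c + a + c)) <
        Module.finrank k (Fin (Module.finrank k (degreeFiltration e B)) →
          degreeFiltration e a) := by
      rw [Module.finrank_pi_fintype]
      simp only [finrank_degreeFiltration, Finset.sum_const, Finset.card_univ, Fintype.card_fin,
        smul_eq_mul]
      calc _ < Fintype.card ι * (B * (Fintype.card ι * a)) := Nat.mul_lt_mul_of_pos_left ha hι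
        _ = _ := by ring
    have := LinearMap.ker_ne_bot_of_finrank_lt hlt (f := Ψ)
    obtain ⟨r, hr, hr0⟩ := Submodule.exists_mem_ne_zero_of_ne_bot this
    exact ⟨r, hr, hr0⟩
  have hsum : ∑ j, u j ^ μ * (r j : A) = 0 := by rw [← hΨ, hr]; rfl
  set w : A := ∑ j, u j * g.symm (r j) ^ ν with hw
  have hw0 : w ≠ 0 := by
    intro h0
    have h1 : ∑ j, (φ ∘ u) j * (φ (g.symm (r j))) ^ p ^ (f * (n / 2)) = 0 := by
      have := congrArg φ h0
      rw [hw, map_sum, map_zero] at this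
      rw [← this]
      refine Finset.sum_congr rfl fun j _ => ?_
      rw [map_mul, map_pow, hν, hf, ← pow_mul]
      rfl
    have h2 := eq_zero_of_sum_mul_pow_eq_zero hN (by rw [pow_mul, ← hf]; exact hνN) h1
    refine hr0 (funext fun j => Subtype.ext ?_)
    by_contra hj
    have hj' : g.symm (r j) ≠ 0 := fun h => hj (by simpa using h)
    have h3 := hφ 1 (fun _ => g.symm (r j)) (LinearIndependent.of_subsingleton 0 hj')
    exact h3.ne_zero 0 (congrFun h2 j)
  have hwmem : w ∈ degreeFiltration e (B + (ν * (a + c + c) + c) + c) :=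
    Submodule.sum_mem _ fun j _ => hmul _ _ _ _ (huB j)
      (pow_mem_degreeFiltration hmul hone (hmap _ _ (r j).2) ν)
  have hsub : {P : A →ₐ[k] Ω | ∀ x, P x ^ Nat.card k ^ n = P (g x)} ⊆
      {P : A →ₐ[k] Ω | P w = 0} := by
    intro P hP
    have h1 : P w ^ μ = 0 := by
      have hμp : μ = p ^ (f * (n - n / 2)) := by rw [hμ, hf, ← pow_mul]
      have h2 : P w ^ μ = ∑ j, (P (u j) * P (g.symm (r j)) ^ ν) ^ μ := by
        rw [hw, map_sum, hμp, sum_pow_char_pow]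
        simp only [map_mul, map_pow]
      have h3 := congrArg P hsum
      rw [map_zero, map_sum] at h3
      rw [h2, ← h3]
      refine Finset.sum_congr rfl fun j _ => ?_
      rw [mul_pow, ← pow_mul, mul_comm ν μ, hμν, hP, g.apply_symm_apply, map_mul, map_pow]
    exact pow_eq_zero_iff (by positivity) |>.1 h1
  obtain ⟨hfin, hcard⟩ := ncard_algHom_zeros_le (Ω := Ω) e hmul hbasis hw0 hwmem
  refine ⟨hfin.subset hsub, ?_⟩
  have h4 := (Set.ncard_le_ncard hsub hfin).trans hcard
  have h5 : ((μ : ℝ) * ν) = (Nat.card k : ℝ) ^ n := by exact_mod_cast hμν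
  rw [← h5]
  refine le_trans ?_ hbound
  exact_mod_cast h4

end Stepanov

section Hensel

/-- Hensel's lemma for power series: a simple root of the reduction lifts. -/
theorem exists_powerSeries_root {Ω : Type*} [Field Ω] (F : (PowerSeries Ω)[X])
    (hdeg : (F.map PowerSeries.constantCoeff).natDegree = F.natDegree)
    {x : Ω} (hx : (F.map PowerSeries.constantCoeff).eval x = 0)
    (hx' : (F.map PowerSeries.constantCoeff).derivative.eval x ≠ 0) :
    ∃ y : PowerSeries Ω, F.eval y = 0 ∧ PowerSeries.constantCoeff y = x := by
  have hF0 : F.map PowerSeries.constantCoeff ≠ 0 := by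
    intro h
    simp [h] at hx'
  have hlc : IsUnit F.leadingCoeff := by
    rw [PowerSeries.isUnit_iff_constantCoeff, isUnit_iff_ne_zero]
    have : (F.map PowerSeries.constantCoeff).leadingCoeff ≠ 0 := leadingCoeff_ne_zero.mpr hF0
    rwa [leadingCoeff, hdeg, coeff_map] at this
  obtain ⟨u, hu⟩ := hlc
  have hmonic : (C (↑u⁻¹ : PowerSeries Ω) * F).Monic := by
    refine monic_C_mul_of_mul_leadingCoeff_eq_one ?_
    rw [← hu, Units.inv_mul]
  have key : ∀ G : (PowerSeries Ω)[X], PowerSeries.constantCoeff (G.eval (PowerSeries.C x)) =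
      (G.map PowerSeries.constantCoeff).eval x := by
    intro G
    rw [eval_map, ← PowerSeries.constantCoeff_C (R := Ω) x, eval₂_hom]
    simp
  obtain ⟨y, hy, hyx⟩ := HenselianRing.is_henselian
    (I := Ideal.span {(PowerSeries.X : PowerSeries Ω)})
    _ hmonic (PowerSeries.C x) (by
      rw [Ideal.mem_span_singleton, PowerSeries.X_dvd_iff, eval_mul, map_mul, key F, hx, mul_zero])
    (by
      refine IsUnit.map _ ?_
      rw [PowerSeries.isUnit_iff_constantCoeff, derivative_C_mul, eval_mul, map_mul, key (derivative F),
        ← derivative_map]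
      refine IsUnit.mul ?_ ?_
      · rw [eval_C]
        exact (u⁻¹).isUnit.map _
      · exact isUnit_iff_ne_zero.mpr hx')
  refine ⟨y, ?_, ?_⟩
  · rw [IsRoot, eval_mul, eval_C] at hy
    exact (Units.mul_right_eq_zero u⁻¹).mp hy
  · rw [Ideal.mem_span_singleton, PowerSeries.X_dvd_iff, map_sub, PowerSeries.constantCoeff_C,
      sub_eq_zero] at hyx
    exact hyx

/-- Roots reducing to a simple root are determined by their reduction. -/
theorem powerSeries_root_unique {Ω : Type*} [Field Ω] {F : (PowerSeries Ω)[X]}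
    {y z : PowerSeries Ω} (hy : F.eval y = 0) (hz : F.eval z = 0)
    (hyz : PowerSeries.constantCoeff y = PowerSeries.constantCoeff z)
    (h : (F.map PowerSeries.constantCoeff).derivative.eval (PowerSeries.constantCoeff z) ≠ 0) :
    y = z := by
  by_contra hne
  obtain ⟨H, rfl⟩ := dvd_iff_isRoot.mpr hy
  rw [eval_mul, eval_sub, eval_X, eval_C, mul_eq_zero, sub_eq_zero] at hz
  have hH : H.eval z = 0 := hz.resolve_left (Ne.symm hne)
  apply h
  have : (H.map PowerSeries.constantCoeff).eval (PowerSeries.constantCoeff z) = 0 := by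
    rw [eval_map, eval₂_hom, hH, map_zero]
  simp [derivative_mul, this, hyz]

theorem splits_map_of_reduction_separable {Ω M : Type*} [Field Ω] [IsAlgClosed Ω] [Field M]
    [Algebra (PowerSeries Ω) M] [FaithfulSMul (PowerSeries Ω) M] (F : (PowerSeries Ω)[X])
    (hdeg : (F.map PowerSeries.constantCoeff).natDegree = F.natDegree)
    (hsep : (F.map PowerSeries.constantCoeff).Separable) :
    (F.map (algebraMap (PowerSeries Ω) M)).Splits ∧
      (F.map (algebraMap (PowerSeries Ω) M)).roots.Nodup ∧
      ∀ z ∈ (F.map (algebraMap (PowerSeries Ω) M)).roots,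
        ∃ y, algebraMap (PowerSeries Ω) M y = z ∧ F.eval y = 0 := by
  classical
  have hinj := FaithfulSMul.algebraMap_injective (PowerSeries Ω) M
  set F0 := F.map PowerSeries.constantCoeff with hF0
  have hroot : ∀ x ∈ F0.roots.toFinset, ∃ y : PowerSeries Ω, F.eval y = 0 ∧
      PowerSeries.constantCoeff y = x := by
    intro x hx
    rw [Multiset.mem_toFinset, mem_roots hsep.ne_zero] at hx
    exact exists_powerSeries_root F hdeg hx
      (hsep.eval₂_derivative_ne_zero (RingHom.id Ω) hx)
  choose! Y hY hYx using hroot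
  have hFM : F.map (algebraMap (PowerSeries Ω) M) ≠ 0 := by
    rw [Polynomial.map_ne_zero_iff hinj]
    rintro rfl
    exact hsep.ne_zero (by simp [hF0])
  set RM := (F.map (algebraMap (PowerSeries Ω) M)).roots with hRM
  have hmaps : F0.roots.toFinset.image (fun x => algebraMap (PowerSeries Ω) M (Y x)) ⊆
      RM.toFinset := by
    intro z hz
    obtain ⟨x, hx, rfl⟩ := Finset.mem_image.mp hz
    rw [Multiset.mem_toFinset, mem_roots hFM, IsRoot, eval_map, eval₂_hom, hY x hx, map_zero]
  have hcard : (F0.roots.toFinset.image (fun x => algebraMap (PowerSeries Ω) M (Y x))).card =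
      F.natDegree := by
    rw [Finset.card_image_of_injOn, Multiset.toFinset_card_of_nodup (nodup_roots hsep), ← hdeg]
    · exact splits_iff_card_roots.mp (IsAlgClosed.splits F0)
    · intro a ha b hb hab
      rw [← hYx a ha, ← hYx b hb, hinj hab]
  have hnd : (F.map (algebraMap (PowerSeries Ω) M)).natDegree = F.natDegree :=
    natDegree_map_eq_of_injective hinj F
  have h1 : RM.card ≤ F.natDegree := hnd ▸ card_roots' _
  have h2 : RM.toFinset.card ≤ RM.card := Multiset.toFinset_card_le RM
  have h3 := Finset.card_le_card hmaps
  refine ⟨splits_iff_card_roots.mpr (by rw [hnd]; change RM.card = _; omega), ?_, ?_⟩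
  · rw [← Multiset.dedup_eq_self]
    exact Multiset.eq_of_le_of_card_le (Multiset.dedup_le RM) (by
      change RM.card ≤ RM.toFinset.card
      omega)
  · intro z hz
    have : z ∈ F0.roots.toFinset.image (fun x => algebraMap (PowerSeries Ω) M (Y x)) := by
      rw [Finset.eq_of_subset_of_card_le hmaps (by omega), Multiset.mem_toFinset]
      exact hz
    obtain ⟨x, hx, rfl⟩ := Finset.mem_image.mp this
    exact ⟨Y x, rfl, hY x hx⟩

end Hensel

section BadValues

/-- If `p / q` has nonzero derivative, all but finitely many fibres are separable of full degree. -/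
theorem finite_setOf_not_separable {Ω : Type*} [Field Ω] [IsAlgClosed Ω] {p q : Polynomial Ω}
    (hpq : IsCoprime p q) (hw : derivative p * q - p * derivative q ≠ 0) :
    {t : Ω | ¬((p - C t * q).natDegree = max p.natDegree q.natDegree ∧
      (p - C t * q).Separable)}.Finite := by
  classical
  have hq : ∀ x, ¬(p.eval x = 0 ∧ q.eval x = 0) := by
    rintro x ⟨h1, h2⟩
    obtain ⟨a, b, h⟩ := hpq
    have := congrArg (eval x) h
    simp [h1, h2] at this
  set N := max p.natDegree q.natDegree with hN
  set W := derivative p * q - p * derivative q with hW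
  have hfin : ({p.coeff N / q.coeff N} ∪ (fun x => p.eval x / q.eval x) ''
      (W.roots.toFinset : Set Ω) : Set Ω).Finite :=
    (Set.finite_singleton _).union ((Finset.finite_toSet _).image _)
  refine hfin.subset fun t ht => ?_
  by_contra hcon
  simp only [Set.mem_union, Set.mem_singleton_iff, not_or] at hcon
  obtain ⟨hc1, hc2⟩ := hcon
  apply ht
  have hle : (p - C t * q).natDegree ≤ N :=
    (natDegree_sub_le _ _).trans (max_le_max le_rfl (natDegree_C_mul_le _ _))
  have hcoef : (p - C t * q).coeff N ≠ 0 := by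
    rw [coeff_sub, coeff_C_mul, sub_ne_zero]
    intro h
    by_cases hqN : q.coeff N = 0
    · rw [hqN, mul_zero] at h
      rcases le_total p.natDegree q.natDegree with h' | h'
      · have : N = q.natDegree := max_eq_right h'
        rw [this] at hqN h
        have hq0 : q = 0 := leadingCoeff_eq_zero.mp hqN
        subst hq0
        have : p.natDegree = 0 := by simpa using h'
        rw [natDegree_zero, ← this] at h
        have hp0 : p = 0 := leadingCoeff_eq_zero.mp h
        simp [hW, hp0] at hw
      · have : N = p.natDegree := max_eq_left h'
        rw [this] at hqN h
        have hp0 : p = 0 := leadingCoeff_eq_zero.mp h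
        subst hp0
        have : q.natDegree = 0 := by simpa using h'
        rw [natDegree_zero, ← this] at hqN
        have hp0 : q = 0 := leadingCoeff_eq_zero.mp hqN
        simp [hW] at hw
    · exact hc1 (by rw [h, mul_div_cancel_right₀ _ hqN])
  refine ⟨le_antisymm hle (le_natDegree_of_ne_zero hcoef), ?_⟩
  by_contra hsep
  rw [separable_def, isCoprime_iff_aeval_ne_zero_of_isAlgClosed Ω Ω] at hsep
  push Not at hsep
  obtain ⟨x, h1, h2⟩ := hsep
  simp only [coe_aeval_eq_eval, eval_sub, eval_mul, eval_C, derivative_sub, derivative_C_mul]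
    at h1 h2
  have hqx : q.eval x ≠ 0 := fun h => hq x ⟨by simpa [h] using h1, h⟩
  apply hc2
  refine ⟨x, ?_, ?_⟩
  · rw [Finset.mem_coe, Multiset.mem_toFinset, mem_roots hw, IsRoot, hW]
    simp only [eval_sub, eval_mul]
    linear_combination q.eval x * h2 - (derivative q).eval x * h1
  · change p.eval x / q.eval x = t
    rw [div_eq_iff hqx]
    linear_combination h1

/-- The Wronskian of a coprime pair does not vanish if the degree is prime to the
characteristic. -/
theorem wronskian_ne_zero_of_natCast_ne_zero {k : Type*} [Field k] {p q : k[X]}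
    (hpq : IsCoprime p q) (hN : ((max p.natDegree q.natDegree : ℕ) : k) ≠ 0) :
    derivative p * q - p * derivative q ≠ 0 := by
  intro h
  have key : ∀ a b : k[X], IsCoprime a b → derivative a * b - a * derivative b = 0 →
      derivative a = 0 := by
    intro a b hab h
    have h1 : a ∣ derivative a * b := ⟨derivative b, by linear_combination h⟩
    have h2 : a ∣ derivative a := hab.dvd_of_dvd_mul_right h1
    by_contra h0
    by_cases ha : a.natDegree = 0
    · exact h0 (derivative_of_natDegree_zero ha)
    · have := natDegree_le_of_dvd h2 h0
      have := natDegree_derivative_lt ha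
      omega
  have hp := key p q hpq h
  have hq := key q p hpq.symm (by linear_combination -h)
  have hdeg : ∀ a : k[X], derivative a = 0 → (a.natDegree : k) = 0 := by
    intro a ha
    by_cases h0 : a.natDegree = 0
    · simp [h0]
    · have := congrArg (fun f => coeff f (a.natDegree - 1)) ha
      simp only [coeff_derivative, coeff_zero] at this
      rw [Nat.sub_add_cancel (Nat.pos_of_ne_zero h0)] at this
      rcases mul_eq_zero.mp this with h' | h'
      · exact absurd (leadingCoeff_eq_zero.mp h') (by rintro rfl; simp at h0)
      · have e : a.natDegree = (a.natDegree - 1) + 1 := by omega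
        rw [e]
        push_cast
        exact h'
  rcases max_choice p.natDegree q.natDegree with h' | h' <;> rw [h'] at hN
  · exact hN (hdeg p hp)
  · exact hN (hdeg q hq)

end BadValues

section Disjointness

/-- Elements of a field that are independent over an algebraically closed-in subfield stay
independent over algebraic extensions of that subfield. -/
theorem eq_zero_of_sum_mul_eq_zero {k K Ω M : Type*} [Field k] [Finite k] [Field K] [Field Ω]
    [Field M] [Algebra k K] [Algebra k Ω] [Algebra.IsAlgebraic k Ω] (ι : K →+* M) (σ : Ω →+* M)
    (hισ : ι.comp (algebraMap k K) = σ.comp (algebraMap k Ω))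
    (hk : ∀ x : K, IsAlgebraic k x → x ∈ Set.range (algebraMap k K))
    {n : ℕ} {u : Fin n → K} (hu : LinearIndependent k u) (c : Fin n → Ω)
    (hc : ∑ j, σ (c j) * ι (u j) = 0) : c = 0 := by
  classical
  let E : IntermediateField k Ω := IntermediateField.adjoin k (Set.range c)
  have : FiniteDimensional k E := IntermediateField.finiteDimensional_adjoin
    (fun x _ => (Algebra.IsAlgebraic.isAlgebraic x).isIntegral)
  let pb : PowerBasis k E := Field.powerBasisOfFiniteOfSeparable k E
  let c' : Fin n → E := fun j => ⟨c j, IntermediateField.subset_adjoin k _ ⟨j, rfl⟩⟩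
  let α : E := pb.gen
  let σE : E →+* M := σ.comp (algebraMap E Ω)
  have hσk : ∀ a : k, σE (algebraMap k E a) = ι (algebraMap k K a) := fun a =>
    (RingHom.congr_fun hισ a).symm
  let v : Fin pb.dim → K := fun l => ∑ j, (pb.basis.repr (c' j) l) • u j
  let H : K[X] := ∑ l : Fin pb.dim, C (v l) * X ^ (l : ℕ)
  have hexp : ∀ j, σ (c j) = ∑ l, ι (algebraMap k K (pb.basis.repr (c' j) l)) *
      (σE α) ^ (l : ℕ) := by
    intro j
    have h1 : σ (c j) = σE (c' j) := rfl
    rw [h1]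
    conv_lhs => rw [← pb.basis.sum_repr (c' j)]
    rw [map_sum]
    refine Finset.sum_congr rfl fun l _ => ?_
    rw [Algebra.smul_def, map_mul, hσk, pb.basis_eq_pow, map_pow]
  have hH : H.eval₂ ι (σE α) = 0 := by
    rw [← hc]
    simp only [H, eval₂_finsetSum, eval₂_mul, eval₂_C, eval₂_X_pow, v, hexp, map_sum,
      Finset.sum_mul, Algebra.smul_def, map_mul]
    rw [Finset.sum_comm]
    refine Finset.sum_congr rfl fun j _ => Finset.sum_congr rfl fun l _ => ?_
    ring
  let : Algebra K M := ι.toAlgebra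
  have hαint : IsIntegral k α := pb.isIntegral_gen
  have hmk : aeval (σE α) ((minpoly k α).map (algebraMap k K)) = 0 := by
    rw [aeval_def, eval₂_map]
    have : (algebraMap K M).comp (algebraMap k K) = σE.comp (algebraMap k E) :=
      RingHom.ext fun a => (hσk a).symm
    rw [this, ← hom_eval₂, ← aeval_def, minpoly.aeval, map_zero]
  have hαK : IsIntegral K (σE α) := ⟨_, (minpoly.monic hαint).map _, hmk⟩
  have hlift := integralClosure.mem_lifts_of_monic_of_dvd_map K (minpoly.monic hαint)
    (minpoly.monic hαK) (minpoly.dvd K _ hmk)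
  have hlift' : minpoly K (σE α) ∈ lifts (algebraMap k K) := by
    rw [lifts_iff_coeff_lifts] at hlift ⊢
    intro i
    obtain ⟨y, hy⟩ := hlift i
    exact hk _ (hy ▸ (y.2 : IsIntegral k (y : K)).isAlgebraic)
  obtain ⟨D, hD⟩ := hlift'
  rw [coe_mapRingHom] at hD
  have hD0 : aeval α D = 0 := by
    apply σE.injective
    have := minpoly.aeval K (σE α)
    rw [← hD, aeval_def, eval₂_map] at this
    have h2 : (algebraMap K M).comp (algebraMap k K) = σE.comp (algebraMap k E) :=
      RingHom.ext fun a => (hσk a).symm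
    rw [h2, ← hom_eval₂] at this
    rw [aeval_def, this, map_zero]
  have hD1 : D ≠ 0 := by
    rintro rfl
    rw [Polynomial.map_zero] at hD
    exact (minpoly.monic hαK).ne_zero hD.symm
  have hdim : pb.dim ≤ (minpoly K (σE α)).natDegree := by
    rw [← hD, natDegree_map, ← pb.natDegree_minpoly]
    exact natDegree_le_of_dvd (minpoly.dvd k _ hD0) hD1
  have hH0 : H = 0 := by
    by_contra hne
    have h1 := natDegree_le_of_dvd (minpoly.dvd K (σE α) (p := H) hH) hne
    have h2 : H.degree < pb.dim := by
      refine (degree_sum_fin_lt v)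
    have h3 := (natDegree_lt_iff_degree_lt hne).mpr h2
    omega
  have hv : ∀ l, v l = 0 := by
    intro l
    have := congrArg (fun f => coeff f (l : ℕ)) hH0
    simp only [H, finsetSum_coeff, coeff_C_mul, coeff_X_pow, coeff_zero] at this
    rw [Finset.sum_eq_single l] at this
    · simpa using this
    · intro b _ hb
      rw [if_neg (fun h => hb (Fin.ext h.symm)), mul_zero]
    · simp
  funext j
  have h0 : c' j = 0 := by
    apply pb.basis.repr.injective
    ext l
    rw [Fintype.linearIndependent_iff.mp hu _ (hv l) j]
    simp
  exact congrArg Subtype.val h0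

end Disjointness

section Place

variable {k Ω : Type*} [Field k] [Field Ω] [Algebra k Ω]

/-- Taylor expansion at `t`. -/
noncomputable def taylorHom (t : Ω) : k[X] →ₐ[k] PowerSeries Ω :=
  aeval (PowerSeries.C t + PowerSeries.X)

theorem constantCoeff_taylorHom (t : Ω) (a : k[X]) :
    PowerSeries.constantCoeff (taylorHom t a) = aeval t a := by
  rw [taylorHom, aeval_def, hom_eval₂, aeval_def]
  congr 1
  · simp

theorem taylorHom_injective (t : Ω) : Function.Injective (taylorHom (k := k) t) := by
  have h : ∀ a : k[X], taylorHom t a = (((a.map (algebraMap k Ω)).comp (X + C t) : Polynomial Ω) :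
      PowerSeries Ω) := by
    intro a
    rw [taylorHom, aeval_def, comp, eval₂_map]
    rw [← Polynomial.coeToPowerSeries.ringHom_apply, hom_eval₂]
    congr 1
    · refine RingHom.ext fun b => ?_
      simp [PowerSeries.algebraMap_apply]
    · simp [add_comm]
  rw [injective_iff_map_eq_zero]
  intro a ha
  rw [h, Polynomial.coe_eq_zero_iff, comp_X_add_C_eq_zero_iff] at ha
  exact (Polynomial.map_eq_zero _).mp ha

/-- The fibre of `G` over `t` is separable and of full degree. -/
def IsGoodFibre (G : k[X][X]) (t : Ω) : Prop :=
  (G.map (aeval t : k[X] →ₐ[k] Ω).toRingHom).natDegree = G.natDegree ∧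
    (G.map (aeval t : k[X] →ₐ[k] Ω).toRingHom).Separable

theorem map_taylorHom_map_constantCoeff (G : k[X][X]) (t : Ω) :
    (G.map (taylorHom (k := k) t).toRingHom).map PowerSeries.constantCoeff =
      G.map (aeval t : k[X] →ₐ[k] Ω).toRingHom := by
  rw [Polynomial.map_map]
  congr 1
  exact RingHom.ext fun a => constantCoeff_taylorHom t a

theorem natDegree_map_taylorHom (G : k[X][X]) (t : Ω) :
    (G.map (taylorHom (k := k) t).toRingHom).natDegree = G.natDegree :=
  natDegree_map_eq_of_injective (taylorHom_injective t) G

theorem IsGoodFibre.aeval_leadingCoeff_ne_zero {G : k[X][X]} {t : Ω} (h : IsGoodFibre G t) :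
    aeval t G.leadingCoeff ≠ 0 := by
  have := leadingCoeff_ne_zero.mpr h.2.ne_zero
  rwa [leadingCoeff, h.1, coeff_map] at this

variable {L K M : Type*} [Field L] [Algebra k[X] L] [Field K] [Algebra L K]
  [Algebra k[X] K] [IsScalarTower k[X] L K] [Field M] [Algebra (PowerSeries Ω) M]
  {ι : K →+* M} {t : Ω}

theorem map_algebraMap_map_embedding (G : k[X][X])
    (hι : ∀ a, ι (algebraMap k[X] K a) = algebraMap (PowerSeries Ω) M (taylorHom t a)) :
    ((G.map (algebraMap k[X] L)).map (algebraMap L K)).map ι =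
      (G.map (taylorHom (k := k) t).toRingHom).map (algebraMap (PowerSeries Ω) M) := by
  rw [Polynomial.map_map, Polynomial.map_map, Polynomial.map_map]
  congr 1
  refine RingHom.ext fun a => ?_
  rw [RingHom.comp_apply, RingHom.comp_apply, ← IsScalarTower.algebraMap_apply k[X] L K, hι]
  rfl

theorem exists_embedding_of_isGoodFibre [IsFractionRing k[X] L] [FaithfulSMul (PowerSeries Ω) M]
    [IsAlgClosed Ω] (G : k[X][X])
    [IsSplittingField L K (G.map (algebraMap k[X] L))] (ht : IsGoodFibre G t) :
    (∃ ι : K →+* M, ∀ a, ι (algebraMap k[X] K a) = algebraMap (PowerSeries Ω) M (taylorHom t a)) ∧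
      (G.map (algebraMap k[X] L)).Separable := by
  have hinj : Function.Injective
      ((algebraMap (PowerSeries Ω) M).comp (taylorHom (k := k) t).toRingHom) :=
    (FaithfulSMul.algebraMap_injective (PowerSeries Ω) M).comp (taylorHom_injective t)
  let T : L →+* M := IsFractionRing.lift hinj
  have hT : T.comp (algebraMap k[X] L) =
      (algebraMap (PowerSeries Ω) M).comp (taylorHom (k := k) t).toRingHom :=
    RingHom.ext fun a => IsFractionRing.lift_algebraMap hinj a
  let : Algebra L M := T.toAlgebra
  have hmap : (G.map (algebraMap k[X] L)).map (algebraMap L M) =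
      (G.map (taylorHom (k := k) t).toRingHom).map (algebraMap (PowerSeries Ω) M) := by
    rw [Polynomial.map_map, Polynomial.map_map]
    congr 1
  obtain ⟨h1, h2, -⟩ := splits_map_of_reduction_separable (M := M)
    (G.map (taylorHom (k := k) t).toRingHom)
    (by rw [map_taylorHom_map_constantCoeff, natDegree_map_taylorHom, ht.1])
    (by rw [map_taylorHom_map_constantCoeff]; exact ht.2)
  have hG : G ≠ 0 := by
    rintro rfl
    exact ht.2.ne_zero (by simp)
  refine ⟨⟨(IsSplittingField.lift K (G.map (algebraMap k[X] L)) (F := M)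
    (by rw [hmap]; exact h1)).toRingHom, fun a => ?_⟩, ?_⟩
  · rw [IsScalarTower.algebraMap_apply k[X] L K]
    exact ((IsSplittingField.lift K (G.map (algebraMap k[X] L)) (F := M) _).commutes _).trans
      (RingHom.congr_fun hT a)
  · rw [← separable_map (algebraMap L M), hmap]
    refine (nodup_roots_iff_of_splits ?_ h1).mp h2
    rw [Polynomial.map_map, Polynomial.map_ne_zero_iff hinj]
    exact hG

theorem exists_powerSeries_eq_embedding_root [FaithfulSMul (PowerSeries Ω) M] [IsAlgClosed Ω]
    {G : k[X][X]} (ht : IsGoodFibre G t)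
    (hι : ∀ a, ι (algebraMap k[X] K a) = algebraMap (PowerSeries Ω) M (taylorHom t a))
    {r : K} (hr : aeval r (G.map (algebraMap k[X] L)) = 0) :
    ∃ y, algebraMap (PowerSeries Ω) M y = ι r ∧
      (G.map (taylorHom (k := k) t).toRingHom).eval y = 0 := by
  obtain ⟨-, -, h3⟩ := splits_map_of_reduction_separable (M := M)
    (G.map (taylorHom (k := k) t).toRingHom)
    (by rw [map_taylorHom_map_constantCoeff, natDegree_map_taylorHom, ht.1])
    (by rw [map_taylorHom_map_constantCoeff]; exact ht.2)
  apply h3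
  rw [mem_roots, IsRoot, ← map_algebraMap_map_embedding (L := L) G hι, eval_map, eval₂_hom,
    eval_map_algebraMap, hr, map_zero]
  rw [Polynomial.map_map, Polynomial.map_ne_zero_iff]
  · rintro rfl
    exact ht.2.ne_zero (by simp)
  · exact (FaithfulSMul.algebraMap_injective (PowerSeries Ω) M).comp (taylorHom_injective t)

theorem exists_root_eq_embedding [IsFractionRing k[X] L] {G : k[X][X]}
    [IsSplittingField L K (G.map (algebraMap k[X] L))]
    (hG : G ≠ 0)
    (hι : ∀ a, ι (algebraMap k[X] K a) = algebraMap (PowerSeries Ω) M (taylorHom t a))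
    {y : PowerSeries Ω} (hy : (G.map (taylorHom (k := k) t).toRingHom).eval y = 0) :
    ∃ r : K, aeval r (G.map (algebraMap k[X] L)) = 0 ∧ ι r = algebraMap (PowerSeries Ω) M y := by
  have hs := IsSplittingField.splits K (G.map (algebraMap k[X] L))
  have h0 : (G.map (algebraMap k[X] L)).map (algebraMap L K) ≠ 0 := by
    rw [Polynomial.map_ne_zero_iff (algebraMap L K).injective,
      Polynomial.map_ne_zero_iff (IsFractionRing.injective k[X] L)]
    exact hG
  have h1 : algebraMap (PowerSeries Ω) M y ∈
      (((G.map (algebraMap k[X] L)).map (algebraMap L K)).map ι).roots := by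
    rw [mem_roots ((Polynomial.map_ne_zero_iff ι.injective).mpr h0), IsRoot,
      map_algebraMap_map_embedding G hι, eval_map, eval₂_hom, hy, map_zero]
  rw [hs.roots_map ι, Multiset.mem_map] at h1
  obtain ⟨r, hr, hry⟩ := h1
  refine ⟨r, ?_, hry⟩
  rw [mem_roots h0, IsRoot, eval_map_algebraMap] at hr
  exact hr

end Place

section FibrePoints

theorem exists_algEquiv_comp_eq {L K M : Type*} [Field L] [Field K] [Field M] [Algebra L K]
    [Normal L K] (ι ι' : K →+* M) (h : ι.comp (algebraMap L K) = ι'.comp (algebraMap L K)) :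
    ∃ g : K ≃ₐ[L] K, ∀ x, ι (g x) = ι' x := by
  let : Algebra K M := ι.toAlgebra
  let : Algebra L M := (ι.comp (algebraMap L K)).toAlgebra
  have : IsScalarTower L K M := IsScalarTower.of_algebraMap_eq fun _ => rfl
  let ψ : K →ₐ[L] M := { ι' with commutes' := fun x => (RingHom.congr_fun h x).symm }
  exact ⟨ψ.restrictNormal' K, fun x => ψ.restrictNormal_commutes K x⟩

variable {k Ω : Type*} [Field k] [Field Ω] [Algebra k Ω]
  {K M : Type*} [Field K] [Algebra k[X] K]
  [Field M] [Algebra (PowerSeries Ω) M] [IsFractionRing (PowerSeries Ω) M]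
  {ι : K →+* M} {t : Ω}

theorem exists_frobenius_of_embedding {L : Type*} [Field L] [Algebra k[X] L]
    [IsFractionRing k[X] L] [Algebra L K] [IsScalarTower k[X] L K] [Normal L K]
    (hι : ∀ a, ι (algebraMap k[X] K a) = algebraMap (PowerSeries Ω) M (taylorHom t a))
    (θ : Ω →ₐ[k] Ω) (ht : θ t = t) :
    ∃ g : K ≃ₐ[L] K, ∀ x y, algebraMap (PowerSeries Ω) M y = ι x →
      ι (g x) = algebraMap (PowerSeries Ω) M (PowerSeries.map θ.toRingHom y) := by
  have hΦ : Function.Injective ((algebraMap (PowerSeries Ω) M).comp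
      (PowerSeries.map θ.toRingHom)) :=
    (IsFractionRing.injective (PowerSeries Ω) M).comp
      (PowerSeries.map_injective _ θ.toRingHom.injective)
  let Φ : M →+* M := IsFractionRing.lift hΦ
  have hΦa : ∀ y, Φ (algebraMap (PowerSeries Ω) M y) =
      algebraMap (PowerSeries Ω) M (PowerSeries.map θ.toRingHom y) :=
    fun y => IsFractionRing.lift_algebraMap hΦ y
  have hτ : ∀ a : k[X], PowerSeries.map θ.toRingHom (taylorHom t a) = taylorHom t a := by
    intro a
    have h1 : (PowerSeries.mapAlgHom θ).comp (taylorHom (k := k) t) = taylorHom t := by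
      refine Polynomial.algHom_ext ?_
      rw [AlgHom.comp_apply, taylorHom, aeval_X]
      change PowerSeries.map θ.toRingHom _ = _
      rw [map_add, PowerSeries.map_C, PowerSeries.map_X]
      congr 2
    exact DFunLike.congr_fun h1 a
  obtain ⟨g, hg⟩ := exists_algEquiv_comp_eq (L := L) ι (Φ.comp ι) (by
    refine IsFractionRing.injective_comp_algebraMap (A := k[X]) ?_
    refine RingHom.ext fun a => ?_
    simp only [RingHom.comp_apply, ← IsScalarTower.algebraMap_apply k[X] L K]
    rw [hι, hΦa, hτ])
  refine ⟨g, fun x y hxy => ?_⟩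
  rw [hg, RingHom.comp_apply, ← hxy, hΦa]

variable [Algebra k K] [IsScalarTower k k[X] K]

theorem exists_algHom_integralClosure_powerSeries
    (hι : ∀ a, ι (algebraMap k[X] K a) = algebraMap (PowerSeries Ω) M (taylorHom t a)) :
    ∃ φ : integralClosure k[X] K →ₐ[k] PowerSeries Ω,
      ∀ a, algebraMap (PowerSeries Ω) M (φ a) = ι a := by
  have hinj := IsFractionRing.injective (PowerSeries Ω) M
  have hex : ∀ a : integralClosure k[X] K, ∃ y, algebraMap (PowerSeries Ω) M y = ι a := by
    intro a
    rw [← IsIntegrallyClosed.isIntegral_iff]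
    obtain ⟨f, hf, hfa⟩ := (a.2 : IsIntegral k[X] (a : K))
    refine ⟨f.map (taylorHom t).toRingHom, hf.map _, ?_⟩
    have h1 : (algebraMap (PowerSeries Ω) M).comp (taylorHom (k := k) t).toRingHom =
        ι.comp (algebraMap k[X] K) := RingHom.ext fun b => (hι b).symm
    rw [eval₂_map, h1, ← hom_eval₂, hfa, map_zero]
  choose φ hφ using hex
  refine ⟨{ toFun := φ, map_one' := ?_, map_mul' := ?_, map_zero' := ?_, map_add' := ?_,
            commutes' := ?_ }, hφ⟩
  · apply hinj; simp [hφ]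
  · intro a b; apply hinj; simp [hφ]
  · apply hinj; simp [hφ]
  · intro a b; apply hinj; simp [hφ]
  · intro c
    apply hinj
    rw [hφ]
    have h1 : ((algebraMap k (integralClosure k[X] K) c : integralClosure k[X] K) : K) =
        algebraMap k[X] K (C c) := by
      rw [← algebraMap_eq, ← IsScalarTower.algebraMap_apply k k[X] K]
      rfl
    rw [h1, hι, ← algebraMap_eq, AlgHom.commutes]

theorem linearIndependent_comp_of_embedding [Finite k] [Algebra.IsAlgebraic k Ω]
    (hk : ∀ x : K, IsAlgebraic k x → x ∈ Set.range (algebraMap k K))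
    (hι : ∀ a, ι (algebraMap k[X] K a) = algebraMap (PowerSeries Ω) M (taylorHom t a))
    {φ : integralClosure k[X] K →ₐ[k] PowerSeries Ω}
    (hφ : ∀ a, algebraMap (PowerSeries Ω) M (φ a) = ι a)
    {n : ℕ} {u : Fin n → integralClosure k[X] K} (hu : LinearIndependent k u) :
    LinearIndependent Ω (φ ∘ u) := by
  rw [Fintype.linearIndependent_iff]
  intro c hc
  have hu' : LinearIndependent k (fun j => (u j : K)) := by
    have := hu.map' ((integralClosure k[X] K).val.toLinearMap.restrictScalars k)
      (LinearMap.ker_eq_bot.mpr Subtype.val_injective)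
    exact this
  have h := eq_zero_of_sum_mul_eq_zero (k := k) ι
    ((algebraMap (PowerSeries Ω) M).comp PowerSeries.C) ?_ hk hu' c ?_
  · exact fun i => congrFun h i
  · refine RingHom.ext fun a => ?_
    rw [RingHom.comp_apply, IsScalarTower.algebraMap_apply k k[X] K, hι, AlgHom.commutes,
      PowerSeries.algebraMap_apply]
    rfl
  · have := congrArg (algebraMap (PowerSeries Ω) M) hc
    rw [map_zero, map_sum] at this
    rw [← this]
    refine Finset.sum_congr rfl fun j _ => ?_
    rw [PowerSeries.smul_eq_C_mul, map_mul, Function.comp_apply, hφ]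
    rfl

end FibrePoints

section FixedPointProportion

variable {k Ω L K : Type*} [Field k] [Finite k] [Field Ω] [IsAlgClosed Ω] [Algebra k Ω]
  [Field L] [Algebra k[X] L] [IsFractionRing k[X] L]
  [Field K] [Algebra L K] [Algebra k[X] K] [IsScalarTower k[X] L K]
  [Algebra k K] [IsScalarTower k k[X] K]

/-- Above a rational point `t` with a rational preimage, the places of the splitting field give
as many homomorphisms as there are automorphisms, and Frobenius acts on each of them through an
automorphism fixing a root. -/
theorem exists_points_of_isGoodFibre (G : k[X][X])
    [IsSplittingField L K (G.map (algebraMap k[X] L))] [FiniteDimensional L K] {t : Ω} (ht : IsGoodFibre G t) {n : ℕ}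
    (htn : t ^ Nat.card k ^ n = t) {x : Ω} (hxn : x ^ Nat.card k ^ n = x)
    (hx : (G.map (aeval t : k[X] →ₐ[k] Ω).toRingHom).eval x = 0) :
    ∃ g : K ≃ₐ[L] K, (∃ r ∈ (G.map (algebraMap k[X] L)).rootSet K, g r = r) ∧
      ∃ P : (K ≃ₐ[L] K) → (integralClosure k[X] K →ₐ[k] Ω), Function.Injective P ∧
        ∀ h, P h (algebraMap k[X] (integralClosure k[X] K) X) = t ∧ ∀ a, P h a ^ Nat.card k ^ n =
          P h (galRestrict k[X] L K (integralClosure k[X] K) (h⁻¹ * g * h) a) := by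
  classical
  have := Fintype.ofFinite k
  have hG : G ≠ 0 := by
    rintro rfl
    exact ht.2.ne_zero (by simp)
  have hf0 : G.map (algebraMap k[X] L) ≠ 0 := by
    rw [Polynomial.map_ne_zero_iff (IsFractionRing.injective k[X] L)]
    exact hG
  have hnorm : Normal L K := Normal.of_isSplittingField (G.map (algebraMap k[X] L))
  let θ : Ω →ₐ[k] Ω := FiniteField.frobeniusAlgHom k Ω ^ n
  have hθ : ∀ z, θ z = z ^ Nat.card k ^ n := by
    intro z
    rw [Nat.card_eq_fintype_card]
    simp [θ, AlgHom.coe_pow, FiniteField.coe_frobeniusAlgHom, pow_iterate]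
  let M := FractionRing (PowerSeries Ω)
  obtain ⟨⟨ι, hι⟩, -⟩ := exists_embedding_of_isGoodFibre (L := L) (K := K) (M := M) G ht
  obtain ⟨φ, hφ⟩ := exists_algHom_integralClosure_powerSeries hι
  obtain ⟨g, hg⟩ := exists_frobenius_of_embedding (L := L) hι θ (by rw [hθ, htn])
  have hinj := IsFractionRing.injective (PowerSeries Ω) M
  have hsimple : ∀ z : Ω, (G.map (aeval t : k[X] →ₐ[k] Ω).toRingHom).eval z = 0 →
      ((G.map (taylorHom (k := k) t).toRingHom).map
        PowerSeries.constantCoeff).derivative.eval z ≠ 0 := by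
    intro z hz
    rw [map_taylorHom_map_constantCoeff]
    exact ht.2.eval₂_derivative_ne_zero (RingHom.id Ω) hz
  have hdeg : ((G.map (taylorHom (k := k) t).toRingHom).map
      PowerSeries.constantCoeff).natDegree = (G.map (taylorHom (k := k) t).toRingHom).natDegree := by
    rw [map_taylorHom_map_constantCoeff, natDegree_map_taylorHom, ht.1]
  have hred : ∀ y : PowerSeries Ω, (G.map (taylorHom (k := k) t).toRingHom).eval y = 0 →
      (G.map (aeval t : k[X] →ₐ[k] Ω).toRingHom).eval (PowerSeries.constantCoeff y) = 0 := by
    intro y hy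
    rw [← map_taylorHom_map_constantCoeff, eval_map, eval₂_hom, hy, map_zero]
  refine ⟨g, ?_, ?_⟩
  · obtain ⟨y, hy, hyx⟩ := exists_powerSeries_root (G.map (taylorHom (k := k) t).toRingHom) hdeg
      (by rw [map_taylorHom_map_constantCoeff]; exact hx) (hsimple x hx)
    obtain ⟨r, hr, hry⟩ := exists_root_eq_embedding (L := L) hG hι hy
    refine ⟨r, mem_rootSet.mpr ⟨hf0, hr⟩, ι.injective ?_⟩
    have hgr : aeval (g r) (G.map (algebraMap k[X] L)) = 0 := by
      have : aeval (g r) (G.map (algebraMap k[X] L)) = g (aeval r (G.map (algebraMap k[X] L))) :=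
        aeval_algHom_apply g.toAlgHom r _
      rw [this, hr, map_zero]
    obtain ⟨y', hy', hy'0⟩ := exists_powerSeries_eq_embedding_root (L := L) ht hι hgr
    have h1 := hg r y hry.symm
    rw [← hy'] at h1 ⊢
    rw [hry]
    congr 1
    refine powerSeries_root_unique hy'0 hy ?_ ?_
    · rw [hinj h1, hyx]
      change θ (PowerSeries.constantCoeff y) = x
      rw [hyx, hθ, hxn]
    · rw [hyx]
      exact hsimple x hx
  · let c : PowerSeries Ω →ₐ[k] Ω := { PowerSeries.constantCoeff with
      commutes' := fun a => by
        change PowerSeries.constantCoeff (algebraMap k (PowerSeries Ω) a) = _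
        rw [PowerSeries.algebraMap_apply, PowerSeries.constantCoeff_C] }
    have hc : ∀ y, c y = PowerSeries.constantCoeff y := fun _ => rfl
    let ρ := galRestrict k[X] L K (integralClosure k[X] K)
    let P : (K ≃ₐ[L] K) → (integralClosure k[X] K →ₐ[k] Ω) := fun h =>
      (c.comp φ).comp ((ρ h).toAlgHom.restrictScalars k)
    have hP : ∀ h a, P h a = c (φ (ρ h a)) := fun _ _ => rfl
    have hρ : ∀ h a, ((ρ h a : integralClosure k[X] K) : K) = h a := fun h a =>
      algebraMap_galRestrict_apply k[X] h a
    have hfrob : ∀ a, c (φ a) ^ Nat.card k ^ n = c (φ (ρ g a)) := by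
      intro a
      rw [← hθ]
      have h1 := hg a (φ a) (hφ a)
      rw [← hρ, ← hφ] at h1
      rw [hinj h1]
      rfl
    refine ⟨P, ?_, fun h => ⟨?_, fun a => ?_⟩⟩
    · intro h h' hhh
      have hroots : ∀ r ∈ (G.map (algebraMap k[X] L)).rootSet K, h r = h' r := by
        intro r hr
        have hr0 : aeval r (G.map (algebraMap k[X] L)) = 0 := (mem_rootSet.mp hr).2
        have hr1 : aeval r G = 0 := by
          rwa [aeval_map_algebraMap] at hr0
        let a : integralClosure k[X] K := ⟨G.leadingCoeff • r, isIntegral_leadingCoeff_smul G r hr1⟩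
        have key : ∀ s : K ≃ₐ[L] K, ∃ y, algebraMap (PowerSeries Ω) M y = ι (s r) ∧
            (G.map (taylorHom (k := k) t).toRingHom).eval y = 0 ∧
            P s a = aeval t G.leadingCoeff * PowerSeries.constantCoeff y := by
          intro s
          have hsr : aeval (s r) (G.map (algebraMap k[X] L)) = 0 := by
            have : aeval (s r) (G.map (algebraMap k[X] L)) =
              s (aeval r (G.map (algebraMap k[X] L))) := aeval_algHom_apply s.toAlgHom r _
            rw [this, hr0, map_zero]
          obtain ⟨y, hy, hy0⟩ := exists_powerSeries_eq_embedding_root (L := L) ht hι hsr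
          refine ⟨y, hy, hy0, ?_⟩
          have h2 : φ (ρ s a) = taylorHom t G.leadingCoeff * y := by
            apply hinj
            rw [hφ, hρ, map_mul, hy, ← hι, ← map_mul]
            congr 1
            change s (G.leadingCoeff • r) = _
            rw [Algebra.smul_def, map_mul, IsScalarTower.algebraMap_apply k[X] L K,
              AlgEquiv.commutes]
          rw [hP, h2, map_mul, hc, hc, constantCoeff_taylorHom]
        obtain ⟨y, hy, hy0, hya⟩ := key h
        obtain ⟨y', hy', hy'0, hy'a⟩ := key h'
        apply ι.injective
        rw [← hy, ← hy']
        congr 1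
        refine powerSeries_root_unique hy0 hy'0 ?_ (hsimple _ (hred _ hy'0))
        rw [hhh, hy'a] at hya
        exact (mul_left_cancel₀ ht.aeval_leadingCoeff_ne_zero hya).symm
      have h3 : (h : K →ₐ[L] K) = (h' : K →ₐ[L] K) :=
        AlgHom.ext_of_adjoin_eq_top
          (IsSplittingField.adjoin_rootSet K (G.map (algebraMap k[X] L))) hroots
      exact AlgEquiv.ext fun z => DFunLike.congr_fun h3 z
    · have h1 : ρ h (algebraMap k[X] (integralClosure k[X] K) X) =
          algebraMap k[X] (integralClosure k[X] K) X := AlgEquiv.commutes _ _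
      have h2 : φ (algebraMap k[X] (integralClosure k[X] K) X) = taylorHom (k := k) t X := by
        apply hinj
        rw [hφ, ← hι]
        rfl
      rw [hP, h1, h2, hc, constantCoeff_taylorHom, aeval_X]
    · rw [hP, hfrob, hP]
      change _ = c (φ (ρ h (ρ (h⁻¹ * g * h) a)))
      rw [← AlgEquiv.mul_apply, ← AlgEquiv.mul_apply, ← map_mul, ← map_mul]
      congr 4
      group

/-- Counting rational points with a rational preimage: the upper bound in Chebotarev's theorem
for the set of automorphisms fixing a root. -/
theorem eventually_ncard_goodFibre_mul_card_le [Algebra.IsAlgebraic k Ω] (G : k[X][X])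
    [IsSplittingField L K (G.map (algebraMap k[X] L))]
    (hk : ∀ x : K, IsAlgebraic k x → x ∈ Set.range (algebraMap k K))
    (hfin : {t : Ω | ¬ IsGoodFibre G t}.Finite) {ε : ℝ} (hε : 0 < ε) :
    ∀ᶠ n in Filter.atTop,
      ({t : Ω | IsGoodFibre G t ∧ t ^ Nat.card k ^ n = t ∧ ∃ x : Ω, x ^ Nat.card k ^ n = x ∧
        (G.map (aeval t : k[X] →ₐ[k] Ω).toRingHom).eval x = 0}.ncard : ℝ) *
          Nat.card (K ≃ₐ[L] K) ≤
      Nat.card {g : K ≃ₐ[L] K // ∃ r ∈ (G.map (algebraMap k[X] L)).rootSet K, g r = r} *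
        ((1 + ε) * (Nat.card k : ℝ) ^ n) := by
  classical
  have hfd : FiniteDimensional L K :=
    IsSplittingField.finiteDimensional K (G.map (algebraMap k[X] L))
  obtain ⟨t, ht⟩ : ∃ t : Ω, IsGoodFibre G t := by
    have : Infinite Ω := IsAlgClosed.instInfinite
    by_contra! hcon
    exact Set.infinite_univ (hfin.subset fun t _ => hcon t)
  obtain ⟨⟨ι, hι⟩, hsep⟩ := exists_embedding_of_isGoodFibre (L := L) (K := K)
    (M := FractionRing (PowerSeries Ω)) G ht
  obtain ⟨φ, hφ⟩ := exists_algHom_integralClosure_powerSeries hι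
  have hgal : IsGalois L K := IsGalois.of_separable_splitting_field hsep
  let A := integralClosure k[X] K
  have hmf : Module.Finite k[X] A := IsIntegralClosure.finite k[X] L K A
  have htf : Module.IsTorsionFree k[X] L :=
    FaithfulSMul.to_isTorsionFree k[X] L
  have htf' : Module.IsTorsionFree k[X] K := .trans_faithfulSMul k[X] L K
  have hfree : Module.Free k[X] A := IsIntegralClosure.module_free k[X] L K A
  let e := Module.Free.chooseBasis k[X] A
  let Fix := {g : K ≃ₐ[L] K // ∃ r ∈ (G.map (algebraMap k[X] L)).rootSet K, g r = r}
  have := Fintype.ofFinite Fix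
  have hev := Filter.eventually_all.mpr fun g : Fix =>
    eventually_ncard_frobenius_eq_le e φ
      (fun n u hu => linearIndependent_comp_of_embedding hk hι hφ hu)
      (galRestrict k[X] L K A g.1) hε
  filter_upwards [hev] with n hn
  let S : Fix → Set (A →ₐ[k] Ω) := fun g =>
    {P | ∀ x, P x ^ Nat.card k ^ n = P (galRestrict k[X] L K A g.1 x)}
  have hS : ∀ g, Finite (S g) := fun g => (hn g).1
  let T : Set Ω := {t : Ω | IsGoodFibre G t ∧ t ^ Nat.card k ^ n = t ∧
    ∃ x : Ω, x ^ Nat.card k ^ n = x ∧ (G.map (aeval t : k[X] →ₐ[k] Ω).toRingHom).eval x = 0}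
  have hT : ∀ t : T, ∃ g : K ≃ₐ[L] K,
      (∃ r ∈ (G.map (algebraMap k[X] L)).rootSet K, g r = r) ∧
      ∃ P : (K ≃ₐ[L] K) → (A →ₐ[k] Ω), Function.Injective P ∧
        ∀ h, P h (algebraMap k[X] A X) = t ∧ ∀ a, P h a ^ Nat.card k ^ n =
          P h (galRestrict k[X] L K A (h⁻¹ * g * h) a) := by
    rintro ⟨t, ht1, ht2, x, hx1, hx2⟩
    exact exists_points_of_isGoodFibre G ht1 ht2 hx1 hx2
  choose g hgfix P hPinj hPX hPfrob using hT
  have hconj : ∀ t h, ∃ r ∈ (G.map (algebraMap k[X] L)).rootSet K, (h⁻¹ * g t * h) r = r := by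
    intro t h
    obtain ⟨r, hr, hgr⟩ := hgfix t
    refine ⟨h⁻¹ r, ?_, ?_⟩
    · rw [mem_rootSet] at hr ⊢
      refine ⟨hr.1, ?_⟩
      have : aeval (h⁻¹ r) (G.map (algebraMap k[X] L)) =
        h⁻¹ (aeval r (G.map (algebraMap k[X] L))) := aeval_algHom_apply (h⁻¹).toAlgHom r _
      rw [this, hr.2, map_zero]
    · rw [← AlgEquiv.mul_apply, mul_assoc, mul_assoc, mul_inv_cancel, mul_one, AlgEquiv.mul_apply,
        hgr]
  let Ψ : T × (K ≃ₐ[L] K) → Σ g : Fix, S g := fun z =>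
    ⟨⟨z.2⁻¹ * g z.1 * z.2, hconj z.1 z.2⟩, ⟨P z.1 z.2, (hPfrob z.1 z.2)⟩⟩
  have hΨ : Function.Injective Ψ := by
    rintro ⟨t, h⟩ ⟨t', h'⟩ heq
    have h1 : P t h = P t' h' := congrArg (fun z => (z.2 : A →ₐ[k] Ω)) heq
    have h2 : t = t' := Subtype.ext (by rw [← hPX t h, ← hPX t' h', h1])
    subst h2
    rw [hPinj t h1]
  have hle := Nat.card_le_card_of_injective Ψ hΨ
  rw [Nat.card_prod, Nat.card_sigma] at hle
  have hle' : (T.ncard : ℝ) * Nat.card (K ≃ₐ[L] K) ≤ ∑ g : Fix, (Nat.card (S g) : ℝ) := by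
    exact_mod_cast hle
  refine hle'.trans ((Finset.sum_le_sum fun g _ => (hn g).2).trans ?_)
  rw [Finset.sum_const, nsmul_eq_mul, Finset.card_univ, ← Nat.card_eq_fintype_card]

end FixedPointProportion

section Iterates

/-- The value at `(u, v)` of the degree `N` homogenization of `p`. -/
noncomputable def homogEval {F Ω : Type*} [CommRing F] [CommRing Ω] [Algebra F Ω] (N : ℕ) (p : F[X])
    (u v : Ω) : Ω :=
  ∑ i ∈ Finset.range (N + 1), algebraMap F Ω (p.coeff i) * u ^ i * v ^ (N - i)

open Classical in
/-- The point `(u : v)` of the projective line. -/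
noncomputable def toP1 {Ω : Type*} [Field Ω] (u v : Ω) : Option Ω :=
  if v = 0 then none else some (u / v)

variable {F Ω : Type*} [Field F] [Field Ω] [Algebra F Ω]

theorem homogEval_zero_right (N : ℕ) (p : F[X]) (u : Ω) :
    homogEval N p u 0 = algebraMap F Ω (p.coeff N) * u ^ N := by
  rw [homogEval, Finset.sum_eq_single N]
  · simp
  · intro i hi hiN
    have : N - i ≠ 0 := by
      have := Finset.mem_range.mp hi
      omega
    rw [zero_pow this, mul_zero]
  · simp

theorem homogEval_of_ne_zero {N : ℕ} {p : F[X]} (hp : p.natDegree ≤ N) (u : Ω) {v : Ω}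
    (hv : v ≠ 0) : homogEval N p u v = v ^ N * aeval (u / v) p := by
  rw [homogEval, aeval_def, eval₂_eq_sum_range' _ (Nat.lt_succ_of_le hp), Finset.mul_sum]
  refine Finset.sum_congr rfl fun i hi => ?_
  have hi' : i ≤ N := Nat.lt_succ_iff.mp (Finset.mem_range.mp hi)
  rw [div_pow, ← Nat.add_sub_cancel' hi', pow_add, Nat.add_sub_cancel' hi']
  field_simp

variable {p q : F[X]}

theorem coeff_max_natDegree_ne_zero (hpq : IsCoprime p q) :
    ¬(p.coeff (max p.natDegree q.natDegree) = 0 ∧ q.coeff (max p.natDegree q.natDegree) = 0) := by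
  rintro ⟨h1, h2⟩
  rcases le_total p.natDegree q.natDegree with h | h
  · rw [max_eq_right h] at h1 h2
    have hq : q = 0 := leadingCoeff_eq_zero.mp h2
    subst hq
    have hp : p.natDegree = 0 := by simpa using h
    rw [natDegree_zero, ← hp] at h1
    have hp : p = 0 := leadingCoeff_eq_zero.mp h1
    subst hp
    exact not_isUnit_zero (isCoprime_zero_left.mp hpq)
  · rw [max_eq_left h] at h1 h2
    have hp : p = 0 := leadingCoeff_eq_zero.mp h1
    subst hp
    have hq : q.natDegree = 0 := by simpa using h
    rw [natDegree_zero, ← hq] at h2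
    have hq : q = 0 := leadingCoeff_eq_zero.mp h2
    subst hq
    exact not_isUnit_zero (isCoprime_zero_left.mp hpq)

theorem homogEval_ne_zero (hpq : IsCoprime p q) {u v : Ω} (huv : ¬(u = 0 ∧ v = 0)) :
    ¬(homogEval (max p.natDegree q.natDegree) p u v = 0 ∧
      homogEval (max p.natDegree q.natDegree) q u v = 0) := by
  by_cases hv : v = 0
  · subst hv
    have hu : u ≠ 0 := fun h => huv ⟨h, rfl⟩
    rw [homogEval_zero_right, homogEval_zero_right]
    simpa [hu] using coeff_max_natDegree_ne_zero hpq
  · rw [homogEval_of_ne_zero (le_max_left _ _) u hv, homogEval_of_ne_zero (le_max_right _ _) u hv]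
    have := aeval_ne_zero_of_isCoprime hpq (u / v)
    simp only [mul_eq_zero, pow_eq_zero_iff', hv, false_and, false_or]
    tauto

theorem ratMapP1_toP1 (hpq : IsCoprime p q) (hN : 0 < max p.natDegree q.natDegree) {u v : Ω}
    (huv : ¬(u = 0 ∧ v = 0)) :
    ratMapP1 (p.map (algebraMap F Ω)) (q.map (algebraMap F Ω)) (toP1 u v) =
      toP1 (homogEval (max p.natDegree q.natDegree) p u v)
        (homogEval (max p.natDegree q.natDegree) q u v) := by
  by_cases hv : v = 0
  · subst hv
    have hu : u ≠ 0 := fun h => huv ⟨h, rfl⟩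
    have hlt : ∀ {a b : F[X]}, a.natDegree < b.natDegree → a.coeff b.natDegree = 0 :=
      fun h => coeff_eq_zero_of_natDegree_lt h
    rw [homogEval_zero_right, homogEval_zero_right]
    simp only [toP1, if_true, ratMapP1, natDegree_map]
    rcases lt_trichotomy q.natDegree p.natDegree with h | h | h
    · rw [if_pos h, max_eq_left h.le, hlt h]
      simp
    · rw [if_neg (by omega), if_neg (by omega), h, max_self, if_neg, mul_div_mul_right _ _
        (pow_ne_zero _ hu), leadingCoeff_map, leadingCoeff_map, leadingCoeff, leadingCoeff, h]
      have h0 : q.coeff p.natDegree ≠ 0 := by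
        intro h1
        rw [← h] at h1
        have hq : q = 0 := leadingCoeff_eq_zero.mp h1
        subst hq
        rw [← h, natDegree_zero, max_self] at hN
        exact lt_irrefl _ hN
      simpa [hu] using h0
    · rw [if_neg (by omega), if_pos h, max_eq_right h.le, hlt h]
      have h0 : q.coeff q.natDegree ≠ 0 := by
        intro h1
        have := coeff_max_natDegree_ne_zero hpq
        rw [max_eq_right h.le] at this
        exact this ⟨hlt h, h1⟩
      rw [if_neg]
      · simp
      · simpa [hu] using h0
  · have h1 : v ^ max p.natDegree q.natDegree ≠ 0 := pow_ne_zero _ hv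
    rw [homogEval_of_ne_zero (le_max_left _ _) u hv, homogEval_of_ne_zero (le_max_right _ _) u hv]
    simp only [toP1, if_neg hv, ratMapP1, mul_div_mul_left _ _ h1,
      eval_map_algebraMap]
    by_cases hq : aeval (u / v) q = 0
    · rw [if_pos (by rwa [eval_map_algebraMap]), if_pos (by rw [hq, mul_zero])]
    · rw [if_neg (by rwa [eval_map_algebraMap]), if_neg (mul_ne_zero h1 hq)]

theorem aeval_pairComp (r s : F[X]) (x : Ω) :
    aeval x (pairComp p q r s).1 =
        homogEval (max p.natDegree q.natDegree) p (aeval x r) (aeval x s) ∧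
      aeval x (pairComp p q r s).2 =
        homogEval (max p.natDegree q.natDegree) q (aeval x r) (aeval x s) := by
  simp [pairComp, homogEval]

theorem iterPair_spec (hpq : IsCoprime p q) (hN : 0 < max p.natDegree q.natDegree) (x : Ω) (n : ℕ) :
    ¬(aeval x (iterPair p q n).1 = 0 ∧ aeval x (iterPair p q n).2 = 0) ∧
      (ratMapP1 (p.map (algebraMap F Ω)) (q.map (algebraMap F Ω)))^[n] (some x) =
        toP1 (aeval x (iterPair p q n).1) (aeval x (iterPair p q n).2) := by
  induction n with
  | zero => simp [iterPair, toP1]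
  | succ n ih =>
    obtain ⟨h1, h2⟩ := ih
    rw [Function.iterate_succ_apply', h2, ratMapP1_toP1 hpq hN h1]
    simp only [iterPair]
    rw [(aeval_pairComp _ _ x).1, (aeval_pairComp _ _ x).2]
    exact ⟨homogEval_ne_zero hpq h1, rfl⟩

theorem isCoprime_iterPair (hpq : IsCoprime p q) (hN : 0 < max p.natDegree q.natDegree) (n : ℕ) :
    IsCoprime (iterPair p q n).1 (iterPair p q n).2 := by
  rw [isCoprime_iff_aeval_ne_zero_of_isAlgClosed F (AlgebraicClosure F)]
  intro x
  have := (iterPair_spec hpq hN x n).1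
  tauto

theorem natDegree_sum_homog_le (N e : ℕ) {a r s : F[X]} (hr : r.natDegree ≤ e)
    (hs : s.natDegree ≤ e) :
    (∑ i ∈ Finset.range (N + 1), C (a.coeff i) * r ^ i * s ^ (N - i)).natDegree ≤ N * e ∧
      (∑ i ∈ Finset.range (N + 1), C (a.coeff i) * r ^ i * s ^ (N - i)).coeff (N * e) =
        homogEval N a (r.coeff e) (s.coeff e) := by
  have hterm : ∀ i ∈ Finset.range (N + 1), (C (a.coeff i) * r ^ i * s ^ (N - i)).natDegree ≤ N * e ∧
      (C (a.coeff i) * r ^ i * s ^ (N - i)).coeff (N * e) =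
        a.coeff i * r.coeff e ^ i * s.coeff e ^ (N - i) := by
    intro i hi
    have hi' : i ≤ N := Nat.lt_succ_iff.mp (Finset.mem_range.mp hi)
    have h1 : (C (a.coeff i) * r ^ i).natDegree ≤ i * e :=
      (natDegree_C_mul_le _ _).trans (natDegree_pow_le_of_le i hr)
    have h2 : (s ^ (N - i)).natDegree ≤ (N - i) * e := natDegree_pow_le_of_le _ hs
    have h3 : N * e = i * e + (N - i) * e := by rw [← add_mul, Nat.add_sub_cancel' hi']
    rw [h3]
    refine ⟨natDegree_mul_le_of_le h1 h2, ?_⟩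
    rw [coeff_mul_add_eq_of_natDegree_le h1 h2, coeff_C_mul, coeff_pow_of_natDegree_le hr,
      coeff_pow_of_natDegree_le hs]
  refine ⟨natDegree_sum_le_of_forall_le _ _ fun i hi => (hterm i hi).1, ?_⟩
  rw [finsetSum_coeff, homogEval]
  exact Finset.sum_congr rfl fun i hi => (hterm i hi).2

theorem max_natDegree_iterPair (hpq : IsCoprime p q) (hN : 0 < max p.natDegree q.natDegree)
    (n : ℕ) :
    max (iterPair p q n).1.natDegree (iterPair p q n).2.natDegree =
      max p.natDegree q.natDegree ^ n := by
  induction n with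
  | zero => simp [iterPair]
  | succ n ih =>
    have hco := coeff_max_natDegree_ne_zero (isCoprime_iterPair hpq hN n)
    rw [ih] at hco
    have hr := le_max_left (iterPair p q n).1.natDegree (iterPair p q n).2.natDegree
    have hs := le_max_right (iterPair p q n).1.natDegree (iterPair p q n).2.natDegree
    rw [ih] at hr hs
    obtain ⟨h1, h2⟩ := natDegree_sum_homog_le (max p.natDegree q.natDegree) _ (a := p) hr hs
    obtain ⟨h3, h4⟩ := natDegree_sum_homog_le (max p.natDegree q.natDegree) _ (a := q) hr hs
    have h5 := homogEval_ne_zero hpq hco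
    rw [pow_succ', iterPair, pairComp]
    refine le_antisymm (max_le h1 h3) ?_
    by_contra! hlt
    rw [max_lt_iff] at hlt
    exact h5 ⟨by rw [← h2]; exact coeff_eq_zero_of_natDegree_lt hlt.1,
      by rw [← h4]; exact coeff_eq_zero_of_natDegree_lt hlt.2⟩

theorem optionMap_ratMapP1 (θ : Ω →ₐ[F] Ω) (z : Option Ω) :
    (ratMapP1 (p.map (algebraMap F Ω)) (q.map (algebraMap F Ω)) z).map θ =
      ratMapP1 (p.map (algebraMap F Ω)) (q.map (algebraMap F Ω)) (z.map θ) := by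
  cases z with
  | none =>
    simp only [Option.map_none, ratMapP1, leadingCoeff_map]
    split_ifs
    · rfl
    · simp
    · simp
  | some a =>
    simp only [Option.map_some, ratMapP1, eval_map_algebraMap]
    have h : ∀ b : F[X], aeval (θ a) b = θ (aeval a b) := fun b => aeval_algHom_apply θ a b
    by_cases hq : aeval a q = 0
    · rw [if_pos (by rwa [eval_map_algebraMap]), if_pos]
      · rfl
      · rw [eval_map_algebraMap, h, hq, map_zero]
    · rw [if_neg (by rwa [eval_map_algebraMap]), if_neg]
      · simp [h]
      · rwa [eval_map_algebraMap, h, map_eq_zero]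

end Iterates

section PeriodicPoints

/-- A periodic point in `ℙ¹(𝔽_Q)` is the value of the `n`-th iterate at a point of `ℙ¹(𝔽_Q)`. -/
theorem perCount_le {F : Type*} [Field F] [Fintype F] {p q : F[X]} (hpq : IsCoprime p q)
    (hd : 0 < max p.natDegree q.natDegree) (n : ℕ) {N : ℕ} (hN : N ≠ 0)
    {B : Set (AlgebraicClosure F)} (hB : B.Finite) :
    perCount F p q N ≤ {t : AlgebraicClosure F | t ∉ B ∧ t ^ Fintype.card F ^ N = t ∧
      ∃ x : AlgebraicClosure F, x ^ Fintype.card F ^ N = x ∧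
        aeval x (iterPair p q n).1 - t * aeval x (iterPair p q n).2 = 0}.ncard + (B.ncard + 2) := by
  classical
  set T : Set (AlgebraicClosure F) := {t | t ∉ B ∧ t ^ Fintype.card F ^ N = t ∧
      ∃ x : AlgebraicClosure F, x ^ Fintype.card F ^ N = x ∧
        aeval x (iterPair p q n).1 - t * aeval x (iterPair p q n).2 = 0} with hT
  set φ := ratMapP1 (p.map (algebraMap F (AlgebraicClosure F)))
    (q.map (algebraMap F (AlgebraicClosure F))) with hφ
  let θ : AlgebraicClosure F →ₐ[F] AlgebraicClosure F :=
    FiniteField.frobeniusAlgHom F (AlgebraicClosure F) ^ N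
  have hθ : ∀ z, θ z = z ^ Fintype.card F ^ N := by
    intro z
    simp [θ, AlgHom.coe_pow, FiniteField.coe_frobeniusAlgHom, pow_iterate]
  have hfix : ∀ (z : Option (AlgebraicClosure F)) (j : ℕ), z.map θ = z →
      (φ^[j] z).map θ = φ^[j] z := by
    intro z j hz
    induction j with
    | zero => exact hz
    | succ j ih => rw [Function.iterate_succ_apply', hφ, optionMap_ratMapP1, ← hφ, ih]
  have hcard : 1 < Fintype.card F := Fintype.one_lt_card
  have hTfin : T.Finite := by
    have h0 : (X ^ Fintype.card F ^ N - X : Polynomial (AlgebraicClosure F)) ≠ 0 :=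
      FiniteField.X_pow_card_pow_sub_X_ne_zero (AlgebraicClosure F) hN hcard
    refine ((X ^ Fintype.card F ^ N - X :
      Polynomial (AlgebraicClosure F)).roots.toFinset.finite_toSet).subset ?_
    intro t ht
    simp [h0, ht.2.1]
  have hsub : {α : Option (AlgebraicClosure F) |
      (α = none ∨ ∃ a : AlgebraicClosure F, α = some a ∧ a ^ Fintype.card F ^ N = a) ∧
      ∃ m : ℕ, 1 ≤ m ∧ φ^[m] α = α} ⊆ some '' T ∪ (some '' B ∪ {none, φ^[n] none}) := by
    rintro α ⟨rfl | ⟨a, rfl, ha⟩, m, hm, hper⟩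
    · simp
    by_cases haB : a ∈ B
    · exact Or.inr (Or.inl ⟨a, haB, rfl⟩)
    have hα : (some a : Option (AlgebraicClosure F)).map θ = some a := by simp [hθ, ha]
    have h1 : φ^[n] (φ^[n * (m - 1)] (some a)) = some a := by
      rw [← Function.iterate_add_apply]
      have : n + n * (m - 1) = m * n := by
        obtain ⟨m, rfl⟩ := Nat.exists_eq_add_of_le' hm
        simp; ring
      rw [this, Function.iterate_mul]
      exact Function.iterate_fixed hper n
    have h2 := hfix _ (n * (m - 1)) hα
    rcases hβ : φ^[n * (m - 1)] (some a) with _ | x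
    · rw [hβ] at h1
      exact Or.inr (Or.inr (by simp [h1]))
    · rw [hβ] at h1 h2
      have hx : x ^ Fintype.card F ^ N = x := by
        rw [← hθ]
        simpa using h2
      have h3 := (iterPair_spec (Ω := AlgebraicClosure F) hpq hd x n).2
      rw [← hφ, h1, toP1] at h3
      split_ifs at h3 with hv
      refine Or.inl ⟨a, ⟨haB, ha, x, hx, ?_⟩, rfl⟩
      rw [Option.some.inj h3, div_mul_cancel₀ _ hv, sub_self]
  calc perCount F p q N ≤ (some '' T ∪ (some '' B ∪ {none, φ^[n] none})).ncard :=
        Set.ncard_le_ncard hsub ((hTfin.image _).union ((hB.image _).union (Set.toFinite _)))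
    _ ≤ (some '' T).ncard + ((some '' B).ncard +
          ({none, φ^[n] none} : Set (Option (AlgebraicClosure F))).ncard) :=
        (Set.ncard_union_le _ _).trans (by gcongr; exact Set.ncard_union_le _ _)
    _ ≤ T.ncard + (B.ncard + 2) := by
        gcongr
        · exact Set.ncard_image_le hTfin
        · exact Set.ncard_image_le hB
        · exact (Set.ncard_insert_le _ _).trans (by rw [Set.ncard_singleton])

end PeriodicPoints

section FibrePolynomial

variable {k : Type*} [Field k]

/-- The numerator of `u / v - t` as a polynomial over `k[t]`. -/
noncomputable def fibrePoly (u v : k[X]) : k[X][X] := u.map C - C X * v.map C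

theorem natDegree_fibrePoly {u v : k[X]} (h : IsCoprime u v) :
    (fibrePoly u v).natDegree = max u.natDegree v.natDegree := by
  apply le_antisymm
  · refine (natDegree_sub_le _ _).trans (max_le_max natDegree_map_le ?_)
    exact (natDegree_C_mul_le _ _).trans natDegree_map_le
  · apply le_natDegree_of_ne_zero
    intro h0
    have h1 := congrArg (fun f : k[X] => f.coeff 0) h0
    have h2 := congrArg (fun f : k[X] => f.coeff 1) h0
    simp [fibrePoly, coeff_C] at h1 h2
    exact coeff_max_natDegree_ne_zero h ⟨h1, h2⟩

theorem map_fibrePoly {A : Type*} [CommRing A] [Algebra k A] (u v : k[X]) (f : k[X] →+* A)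
    (hf : f.comp C = algebraMap k A) :
    (fibrePoly u v).map f = u.map (algebraMap k A) - C (f X) * v.map (algebraMap k A) := by
  simp [fibrePoly, Polynomial.map_sub, Polynomial.map_mul, Polynomial.map_map, hf]

theorem isGoodFibre_fibrePoly_iff {Ω : Type*} [Field Ω] [Algebra k Ω] {u v : k[X]}
    (h : IsCoprime u v) (t : Ω) :
    IsGoodFibre (fibrePoly u v) t ↔
      (u.map (algebraMap k Ω) - C t * v.map (algebraMap k Ω)).natDegree =
        max u.natDegree v.natDegree ∧
      (u.map (algebraMap k Ω) - C t * v.map (algebraMap k Ω)).Separable := by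
  rw [IsGoodFibre, natDegree_fibrePoly h, map_fibrePoly]
  · simp
  · ext; simp

theorem finite_setOf_not_isGoodFibre_fibrePoly {Ω : Type*} [Field Ω] [IsAlgClosed Ω] [Algebra k Ω]
    {u v : k[X]} (h : IsCoprime u v) (hN : ((max u.natDegree v.natDegree : ℕ) : k) ≠ 0) :
    {t : Ω | ¬ IsGoodFibre (fibrePoly u v) t}.Finite := by
  simp only [isGoodFibre_fibrePoly_iff h]
  have h' := (h.map (mapRingHom (algebraMap k Ω)))
  have := finite_setOf_not_separable h' (wronskian_ne_zero_of_natCast_ne_zero h' ?_)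
  · simpa using this
  · simpa using (map_ne_zero_iff (algebraMap k Ω) (algebraMap k Ω).injective).mpr hN

end FibrePolynomial

section ConstantExtension

/-- Automorphisms over two base fields agree when they fix the same elements. -/
theorem exists_equiv_algEquiv {L₀ L K : Type*} [Field L₀] [Field L] [Field K] [Algebra L₀ K]
    [Algebra L K] {A : (K ≃ₐ[L₀] K) → Prop}
    (h : ∀ g : K ≃ₐ[L₀] K, A g → ∀ x, g (algebraMap L K x) = algebraMap L K x)
    (h' : ∀ g : K ≃ₐ[L] K, ∀ x, g (algebraMap L₀ K x) = algebraMap L₀ K x)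
    (hA : ∀ (g : K ≃ₐ[L₀] K) (g' : K ≃ₐ[L] K), (∀ x, g x = g' x) → A g) :
    ∃ e : {g : K ≃ₐ[L₀] K // A g} ≃ (K ≃ₐ[L] K), ∀ g x, e g x = g.1 x := by
  refine ⟨⟨fun g => AlgEquiv.ofRingEquiv (f := g.1.toRingEquiv) (h g.1 g.2),
    fun g => ⟨AlgEquiv.ofRingEquiv (f := g.toRingEquiv) (h' g), hA _ g fun x => rfl⟩,
    fun g => ?_, fun g => ?_⟩, fun g x => rfl⟩
  · ext; rfl
  · ext; rfl

/-- The bound for the number of rational points in fibres, over a base field which is not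
algebraically closed in the splitting field. -/
theorem eventually_ncard_fibre_mul_card_le {F K : Type*} [Field F] [Finite F] [Field K]
    [Algebra (RatFunc F) K] [Algebra F K] [IsScalarTower F (RatFunc F) K] {u v : F[X]}
    (huv : IsCoprime u v) (hN : ((max u.natDegree v.natDegree : ℕ) : F) ≠ 0)
    {f : (RatFunc F)[X]} (hf : f = u.map RatFunc.C - C RatFunc.X * v.map RatFunc.C)
    [IsSplittingField (RatFunc F) K f] [Finite (algebraicClosure F K)] {ε : ℝ} (hε : 0 < ε) :
    ∃ B : Set (AlgebraicClosure F), B.Finite ∧ ∀ᶠ j in Filter.atTop,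
      ({t : AlgebraicClosure F | t ∉ B ∧ t ^ Nat.card (algebraicClosure F K) ^ j = t ∧
        ∃ x : AlgebraicClosure F, x ^ Nat.card (algebraicClosure F K) ^ j = x ∧
          aeval x u - t * aeval x v = 0}.ncard : ℝ) *
        Nat.card {g : K ≃ₐ[RatFunc F] K // ∀ x, IsAlgebraic F x → g x = x} ≤
      Nat.card {g : K ≃ₐ[RatFunc F] K // (∀ x, IsAlgebraic F x → g x = x) ∧
          ∃ r ∈ f.rootSet K, g r = r} *
        ((1 + ε) * (Nat.card (algebraicClosure F K) : ℝ) ^ j) := by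
  classical
  let k := algebraicClosure F K
  have hkalg : Algebra.IsAlgebraic F k := inferInstance
  let T : K := algebraMap (RatFunc F) K RatFunc.X
  have hT : Transcendental k T := fun h =>
    (transcendental_algebraMap_iff (algebraMap (RatFunc F) K).injective).mpr
      RatFunc.transcendental_X (h.restrictScalars F)
  let : Algebra k[X] K := (aeval T : k[X] →ₐ[k] K).toRingHom.toAlgebra
  have hmap : ∀ a : k[X], algebraMap k[X] K a = aeval T a := fun _ => rfl
  have : IsScalarTower k k[X] K := IsScalarTower.of_algebraMap_eq fun x => by
    rw [hmap]; simp
  have : FaithfulSMul k[X] K := (faithfulSMul_iff_algebraMap_injective _ _).mpr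
    (transcendental_iff_injective.mp hT)
  let L := FractionRing k[X]
  let : Algebra L K := FractionRing.liftAlgebra k[X] K
  have : IsScalarTower k[X] L K := FractionRing.isScalarTower_liftAlgebra k[X] K
  let σ : k →ₐ[F] AlgebraicClosure F := IsAlgClosed.lift
  let : Algebra k (AlgebraicClosure F) := σ.toRingHom.toAlgebra
  have : IsScalarTower F k (AlgebraicClosure F) :=
    IsScalarTower.of_algebraMap_eq fun x => (σ.commutes x).symm
  have : Algebra.IsAlgebraic k (AlgebraicClosure F) := Algebra.IsAlgebraic.tower_top (K := F) k
  let u' := u.map (algebraMap F k)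
  let v' := v.map (algebraMap F k)
  have huv' : IsCoprime u' v' := huv.map (mapRingHom (algebraMap F k))
  have hN' : ((max u'.natDegree v'.natDegree : ℕ) : k) ≠ 0 := by
    simpa [u', v'] using (map_ne_zero_iff (algebraMap F k) (algebraMap F k).injective).mpr hN
  let G := fibrePoly u' v'
  have hkK : ∀ x : K, IsAlgebraic k x → x ∈ Set.range (algebraMap k K) := by
    intro x hx
    exact ⟨⟨x, mem_algebraicClosure_iff.mpr (hx.restrictScalars F)⟩, rfl⟩
  have hpoly : ∀ a : F[X], algebraMap (RatFunc F) K (algebraMap F[X] (RatFunc F) a) =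
      algebraMap k[X] K (a.map (algebraMap F k)) := by
    intro a
    rw [hmap, aeval_map_algebraMap, aeval_algebraMap_apply, RatFunc.aeval_X_left_eq_algebraMap]
  have hbase : ∀ x : RatFunc F, algebraMap (RatFunc F) K x ∈ Set.range (algebraMap L K) := by
    intro x
    obtain ⟨a, b, -, rfl⟩ := IsFractionRing.div_surjective (A := F[X]) x
    refine ⟨algebraMap k[X] L (a.map (algebraMap F k)) /
      algebraMap k[X] L (b.map (algebraMap F k)), ?_⟩
    rw [map_div₀, map_div₀, hpoly, hpoly, ← IsScalarTower.algebraMap_apply,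
      ← IsScalarTower.algebraMap_apply]
  have hGf : (G.map (algebraMap k[X] L)).map (algebraMap L K) =
      f.map (algebraMap (RatFunc F) K) := by
    have h1 : (algebraMap (RatFunc F) K).comp RatFunc.C = algebraMap F K := by
      rw [IsScalarTower.algebraMap_eq F (RatFunc F) K, RatFunc.algebraMap_eq_C]
    rw [Polynomial.map_map, ← IsScalarTower.algebraMap_eq, map_fibrePoly u' v' (algebraMap k[X] K)
      (IsScalarTower.algebraMap_eq k k[X] K).symm, hmap, aeval_X, hf]
    simp only [u', v', Polynomial.map_sub, Polynomial.map_mul, Polynomial.map_map, map_C, h1,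
      ← IsScalarTower.algebraMap_eq]
    rfl
  have hroot : (G.map (algebraMap k[X] L)).rootSet K = f.rootSet K := by
    rw [rootSet, rootSet, aroots, aroots, hGf]
  have : IsSplittingField L K (G.map (algebraMap k[X] L)) := by
    constructor
    · rw [hGf]
      exact IsSplittingField.splits K f
    · rw [hroot, eq_top_iff]
      rintro x -
      have hx : x ∈ Algebra.adjoin (RatFunc F) (f.rootSet K) := by
        rw [IsSplittingField.adjoin_rootSet]
        trivial
      induction hx using Algebra.adjoin_induction with
      | mem x hx => exact Algebra.subset_adjoin hx
      | algebraMap r =>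
        obtain ⟨y, hy⟩ := hbase r
        rw [← hy]
        exact Subalgebra.algebraMap_mem _ y
      | add x y _ _ hx hy => exact add_mem hx hy
      | mul x y _ _ hx hy => exact mul_mem hx hy
  refine ⟨{t | ¬ IsGoodFibre G t}, finite_setOf_not_isGoodFibre_fibrePoly huv' hN', ?_⟩
  filter_upwards [eventually_ncard_goodFibre_mul_card_le (L := L) (K := K)
    (Ω := AlgebraicClosure F) G hkK (finite_setOf_not_isGoodFibre_fibrePoly huv' hN') hε] with j hj
  obtain ⟨e, he⟩ := exists_equiv_algEquiv (L₀ := RatFunc F) (L := L) (K := K)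
    (A := fun g => ∀ x, IsAlgebraic F x → g x = x) (by
      intro g hg x
      have hX : ∀ a : k[X], g (algebraMap k[X] K a) = algebraMap k[X] K a := by
        intro a
        rw [hmap, aeval_eq_sum_range, map_sum]
        refine Finset.sum_congr rfl fun i _ => ?_
        rw [Algebra.smul_def, map_mul, map_pow, g.commutes,
          hg (algebraMap k K (a.coeff i)) (mem_algebraicClosure_iff.mp (a.coeff i).2)]
      obtain ⟨a, b, -, rfl⟩ := IsFractionRing.div_surjective (A := k[X]) x
      rw [map_div₀, map_div₀, ← IsScalarTower.algebraMap_apply, ← IsScalarTower.algebraMap_apply,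
        hX, hX]) (by
      intro g x
      obtain ⟨y, hy⟩ := hbase x
      rw [← hy, g.commutes]) (by
      intro g g' hgg x hx
      have : x = algebraMap L K (algebraMap k[X] L (C ⟨x, mem_algebraicClosure_iff.mpr hx⟩)) := by
        rw [← IsScalarTower.algebraMap_apply, hmap, aeval_C]
        rfl
      rw [hgg, this, g'.commutes])
  have hcard : Nat.card {g : K ≃ₐ[RatFunc F] K // (∀ x, IsAlgebraic F x → g x = x) ∧
      ∃ r ∈ f.rootSet K, g r = r} =
      Nat.card {g : K ≃ₐ[L] K // ∃ r ∈ (G.map (algebraMap k[X] L)).rootSet K, g r = r} := by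
    refine Nat.card_congr ((Equiv.subtypeSubtypeEquivSubtypeInter _ _).symm.trans
      (e.subtypeEquiv fun g => ?_))
    simp only [he, hroot]
  rw [hcard, Nat.card_congr e]
  refine le_trans (le_of_eq ?_) hj
  congr 4
  ext t
  have h2 : G.map (aeval t : k[X] →ₐ[k] AlgebraicClosure F).toRingHom =
      u.map (algebraMap F _) - C t * v.map (algebraMap F _) := by
    rw [map_fibrePoly u' v' _ (by ext; simp)]
    simp [u', v', Polynomial.map_map, ← IsScalarTower.algebraMap_eq]
  simp only [not_not, h2, eval_sub, eval_mul, eval_C, eval_map_algebraMap]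
  rfl

end ConstantExtension

theorem algebraicOver_iff_isAlgebraic {A B : Type*} [CommRing A] [CommRing B] [Algebra A B]
    {σ : A →+* B} (hσ : σ = algebraMap A B) (x : B) : algebraicOver σ x ↔ IsAlgebraic A x := by
  subst hσ
  rfl

theorem div_lt_div_add_of_le {r s a b c Q δ : ℝ} (hδ : 0 < δ) (hb : 0 < b) (ha : 0 ≤ a)
    (hab : a ≤ b) (hrs : r ≤ s + c) (hs : s * b ≤ a * ((1 + δ / 2) * Q)) (hc : 0 ≤ c)
    (hQ : 2 * c / δ < Q) : r / (Q + 1) < a / b + δ := by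
  have hQ0 : 0 < Q := lt_of_le_of_lt (by positivity) hQ
  rw [div_lt_iff₀ hδ] at hQ
  have h1 : s ≤ a / b * ((1 + δ / 2) * Q) := by
    rw [div_mul_eq_mul_div]
    exact (le_div_iff₀ hb).mpr hs
  have h2 : a / b ≤ 1 := (div_le_one hb).mpr hab
  have h3 : 0 ≤ a / b := by positivity
  rw [div_lt_iff₀ (by positivity)]
  nlinarith [mul_le_mul_of_nonneg_right h2 (by positivity : 0 ≤ δ / 2 * Q)]

theorem stmt_7 (F : Type*) [Field F] [Fintype F]
    (p q : Polynomial F) (hco : IsCoprime p q)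
    (hd2 : 2 ≤ max p.natDegree q.natDegree)
    (hdp : max p.natDegree q.natDegree < ringChar F)
    (n : ℕ) (hn : 1 ≤ n) (m : ℕ)
    (hm : Nat.card {x : (PhiPoly F p q n).SplittingField //
        algebraicOver ((algebraMap (RatFunc F) (PhiPoly F p q n).SplittingField).comp
          (RatFunc.C : F →+* RatFunc F)) x} = Fintype.card F ^ m) :
    ∀ δ : ℝ, 0 < δ → ∃ k₀ : ℕ, ∀ k : ℕ, k₀ < k →
      (perCount F p q (m * k) : ℝ) / ((Fintype.card F : ℝ) ^ (m * k) + 1) <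
        (Nat.card {g : (PhiPoly F p q n).Gal //
            (∀ x : (PhiPoly F p q n).SplittingField,
              algebraicOver ((algebraMap (RatFunc F) (PhiPoly F p q n).SplittingField).comp
                (RatFunc.C : F →+* RatFunc F)) x → g x = x) ∧
            ∃ r ∈ (PhiPoly F p q n).rootSet (PhiPoly F p q n).SplittingField, g r = r} : ℝ)
          / (Nat.card {g : (PhiPoly F p q n).Gal //
              ∀ x : (PhiPoly F p q n).SplittingField,
                algebraicOver ((algebraMap (RatFunc F) (PhiPoly F p q n).SplittingField).comp
                  (RatFunc.C : F →+* RatFunc F)) x → g x = x} : ℝ) + δ := by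
  intro δ hδ
  have hσ : (algebraMap (RatFunc F) (PhiPoly F p q n).SplittingField).comp
      (RatFunc.C : F →+* RatFunc F) = algebraMap F (PhiPoly F p q n).SplittingField := by
    rw [IsScalarTower.algebraMap_eq F (RatFunc F), RatFunc.algebraMap_eq_C]
  have hcardF : 1 < Fintype.card F := Fintype.one_lt_card
  simp only [algebraicOver_iff_isAlgebraic hσ] at hm ⊢
  have hk : Nat.card (algebraicClosure F (PhiPoly F p q n).SplittingField) =
      Fintype.card F ^ m := by
    rw [← hm]
    exact Nat.card_congr (Equiv.subtypeEquivRight fun x => mem_algebraicClosure_iff)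
  have : Finite (algebraicClosure F (PhiPoly F p q n).SplittingField) :=
    Nat.finite_of_card_ne_zero (by rw [hk]; positivity)
  have hm0 : m ≠ 0 := by
    rintro rfl
    have := Finite.one_lt_card (α := algebraicClosure F (PhiPoly F p q n).SplittingField)
    rw [hk, pow_zero] at this
    exact lt_irrefl _ this
  have hd0 : 0 < max p.natDegree q.natDegree := by omega
  have hN : ((max (iterPair p q n).1.natDegree (iterPair p q n).2.natDegree : ℕ) : F) ≠ 0 := by
    rw [max_natDegree_iterPair hco hd0, Nat.cast_pow]
    refine pow_ne_zero _ fun h => ?_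
    exact absurd (Nat.le_of_dvd hd0 ((ringChar.spec F _).mp h)) (by omega)
  obtain ⟨B, hB, hev⟩ := eventually_ncard_fibre_mul_card_le
    (K := (PhiPoly F p q n).SplittingField) (isCoprime_iterPair hco hd0 n) hN
    (f := PhiPoly F p q n) rfl (half_pos hδ)
  have hbig : ∀ᶠ j in Filter.atTop, 2 * ((B.ncard : ℝ) + 2) / δ < (Fintype.card F : ℝ) ^ j :=
    (tendsto_pow_atTop_atTop_of_one_lt (by exact_mod_cast hcardF)).eventually_gt_atTop _
  obtain ⟨j₀, hj₀⟩ := Filter.eventually_atTop.mp hev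
  obtain ⟨j₁, hj₁⟩ := Filter.eventually_atTop.mp hbig
  refine ⟨max j₀ j₁, fun j hj => ?_⟩
  have hle := hj₀ j (by omega)
  have hge := hj₁ (m * j) (by nlinarith [Nat.one_le_iff_ne_zero.mpr hm0, le_max_right j₀ j₁])
  rw [hk, ← pow_mul] at hle
  have hper : (perCount F p q (m * j) : ℝ) ≤ _ :=
    Nat.cast_le.mpr (perCount_le hco hd0 n (mul_ne_zero hm0 (by omega)) hB)
  push_cast at hper hle
  rw [← pow_mul] at hle
  refine div_lt_div_add_of_le hδ ?_ (by positivity) ?_ hper hle (by positivity) hge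
  · have : Nonempty {g : (PhiPoly F p q n).Gal //
        ∀ x : (PhiPoly F p q n).SplittingField, IsAlgebraic F x → g x = x} := ⟨1, fun _ _ => rfl⟩
    exact Nat.cast_pos.mpr Nat.card_pos
  · rw [Nat.cast_le]
    exact Nat.card_le_card_of_injective (fun g => ⟨g.1, g.2.1⟩)
      fun g g' h => Subtype.ext (congrArg (fun z => z.1) h :)
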